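/- arXiv:2409.14462 — 2 statements merged into one kernel-verified Lean document; each statement's English description precedes it below -/
import Mathlib

section
/- (Corollary 3) Let k ≥ 1, let p_1 < p_2 < ⋯ < p_k be distinct primes, q = ∏_{i=1}^k p_i, m_i ≥ 2 and 0 ≤ n_i ≤ m_i−1 for each i, m = ∑ m_i, L = ∏ p_i^{m_i}, K = ∏ p_i^{n_i+1}. For each i let J_i be an n_i-element subset of the i-th block of indices {m_1+⋯+m_{i−1}+1, …, m_1+⋯+m_i}, and fix functions f_{i,j}, f'_{i,j} : ℤ_q → ℤ_q for 1 ≤ i ≤ k, 1 ≤ j ≤ m_i−n_i−1. For each c in the product of restriction alphabets ∏_i {0,…,p_i−1}^{n_i} choose bijections π_i^c : {1,…,m_i−n_i} → (i-th block) \ J_i, and choose functions g_{i,j'} : ℤ_q → ℤ_q (1 ≤ j' ≤ m_i−n_i), f_{i'}, h_{i'} : ℤ_q → ℤ_q and λ_{i'} ∈ ℤ_q (1 ≤ i' ≤ k−1); define f on mixed-radix digit vectors so that whenever the J-coordinates of x equal c, f(x) = ∑_{i=1}^k [ (q/p_i) ∑_{j=1}^{m_i−n_i−1} f_{i,j}(x_{π_i^c(j)})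 f'_{i,j}(x_{π_i^c(j+1)}) + ∑_{j'=1}^{m_i−n_i} g_{i,j'}(x_{π_i^c(j')}) ] + ∑_{i'=1}^{k−1} λ_{i'}·f_{i'}(x_{π_{i'}^c(m_{i'}−n_{i'})})·h_{i'}(x_{π_{i'+1}^c(1)}). For t ∈ {0,…,K−1}, write t = t_1 + ∑_{β=2}^k t_β ∏_{α=1}^{β−1} p_α^{n_α+1} with t_u ∈ {0,…,p_u^{n_u+1}−1} and base-p_u digits (t_{u,1},…,t_{u,n_u+1}) of t_u, and let ψ(C_t) be the code whose sequences, indexed by tuples (d_i ∈ {0,…,p_i−1}^{n_i}, d_{i,n_i+1} ∈ {0,…,p_i−1})_{i=1}^k, have x-th entry ξ_q^{f(x) + ∑_{i=1}^k (q/p_i)[ (d_i + t_i)·x_{J_i} + d_{i,n_i+1}·x_{π_i(1)} + t_{i,n_i+1}·x_{π_i(m_i−n_i)} ]}, where t_i = (t_{i,1},…,t_{i,n_i}), x_{J_i} is the vector of J_i-coordinates of x, and π_i = π_i^c on the region where the J-coordinates of x equal c. Then the following are equivalent: (a) for every choice of the g_{i,j'}, f_{i'}, h_{i'}, the λ_{i'}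 ∈ ℤ_q, and the bijections π_i^c, the family {ψ(C_t) : 0 ≤ t < K} is a (K, L)-CCC; (b) for every 1 ≤ i ≤ k and 1 ≤ j ≤ m_i−n_i−1, both f_{i,j} and f'_{i,j} permute {0,…,p_i−1} under reduction modulo p_i. -/
open scoped Classical

/-- Aperiodic cross-correlation function (ACCF) of two length-`L` complex sequences
at integer shift `τ`:
`Θ(a,b)(τ) = ∑_{t=0}^{L−τ−1} a_t · conj(b_{t+τ})` for `0 ≤ τ`, and
`Θ(a,b)(τ) = ∑_{t=0}^{L+τ−1} a_{t−τ} · conj(b_t)` for `τ < 0`. -/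
noncomputable def accf (L : ℕ) (a b : ℕ → ℂ) (τ : ℤ) : ℂ :=
  if 0 ≤ τ then
    ∑ t ∈ Finset.range (L - τ.toNat), a t * (starRingEnd ℂ) (b (t + τ.toNat))
  else
    ∑ t ∈ Finset.range (L - (-τ).toNat), a (t + (-τ).toNat) * (starRingEnd ℂ) (b t)

/-- ACCF (sum) of two codes, i.e. tuples of length-`L` sequences indexed by `κ`:
`Θ(C, C')(τ) = ∑_m Θ(c^m, c'^m)(τ)`. -/
noncomputable def codeACCF {κ : Type*} [Fintype κ] (L : ℕ) (C C' : κ → ℕ → ℂ)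
    (τ : ℤ) : ℂ :=
  ∑ m : κ, accf L (C m) (C' m) τ

/-- A family of codes `C_k` (`k : ι`), each a (`card κ`)-tuple of length-`L` sequences,
is a set of complete complementary codes (CCC) if the number of sequences per code equals
the number `K` of codes, `Θ(C_{k₁}, C_{k₂})(0) = K·L`, and all other aperiodic
auto/cross-correlation sums with `|τ| < L` vanish. -/
noncomputable def IsCCC {ι κ : Type*} [Fintype ι] [Fintype κ] (L : ℕ)
    (C : ι → κ → ℕ → ℂ) : Prop :=
  Fintype.card κ = Fintype.card ι ∧
  ∀ k₁ k₂ : ι, ∀ τ : ℤ, |τ| < (L : ℤ) →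
    codeACCF L (C k₁) (C k₂) τ =
      if τ = 0 ∧ k₁ = k₂ then ((Fintype.card ι : ℂ) * (L : ℂ)) else 0

/-- `ξ_q = exp(2πi/q)`, a primitive `q`-th root of unity. -/
noncomputable def xi (q : ℕ) : ℂ := Complex.exp (2 * Real.pi * Complex.I / q)

/-- `φ : ℤ_q → ℤ_q` permutes `{0,…,p−1}` under reduction modulo `p`: the map sending
`u ∈ {0,…,p−1}` to `φ(u) mod p` is a bijection onto `ℤ_p`. -/
def PermutesMod (q p : ℕ) (φ : ZMod q → ZMod q) : Prop :=
  Function.Bijective (fun u : Fin p => (((φ ((u : ℕ) : ZMod q)).val : ℕ) : ZMod p))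

/-- Mixed-radix digits of `x ∈ {0,…,L−1}`, `L = ∏ p_i^{m_i}`: writing
`x = ∑ σ_i Δ_i` with `Δ_i = ∏_{l<i} p_l^{m_l}` and `0 ≤ σ_i < p_i^{m_i}`,
`bdig p m i x j` is the `(j+1)`-st base-`p i` digit of `σ_i` (the digit of `x` at
the `(j+1)`-st position of the `i`-th block). -/
def bdig {k : ℕ} (p m : Fin k → ℕ) (i : Fin k) (x j : ℕ) : ℕ :=
  x / (∏ l ∈ Finset.Iio i, p l ^ m l) % p i ^ m i / p i ^ j % p i

/-- Mixed-radix block digit regarded as an element of `ℤ_q`, `q = ∏ p_i`. -/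
def bdigZ {k : ℕ} (p m : Fin k → ℕ) (i : Fin k) (x j : ℕ) :
    ZMod (∏ l, p l) := ((bdig p m i x j : ℕ) : ZMod (∏ l, p l))

/-- The restricted function of Corollary 3 (`k` primes, `q = ∏ p_i`, blocks of sizes
`m_i`, restricted at the positions listed by the `J_i`): whenever the `J`-coordinates
of `x` equal `c`,
`f(x) = ∑_i [(q/p_i) ∑_j f_{i,j}(x_{π_i^c(j)}) f'_{i,j}(x_{π_i^c(j+1)})
             + ∑_{j'} g_{i,j'}(x_{π_i^c(j')})]
       + ∑_{i'} λ_{i'}·f_{i'}(x_{π_{i'}^c(m_{i'}−n_{i'})})·h_{i'}(x_{π_{i'+1}^c(1)})`. -/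
def fK (k : ℕ) (hk : 1 ≤ k) (p m n : Fin k → ℕ)
    (hm : ∀ i, 2 ≤ m i) (hn : ∀ i, n i ≤ m i - 1)
    (J : (i : Fin k) → Fin (n i) → Fin (m i))
    (F F' : (i : Fin k) → Fin (m i - n i - 1) → ZMod (∏ l, p l) → ZMod (∏ l, p l))
    (πc : ((i : Fin k) → Fin (n i) → ℕ) →
      (i : Fin k) → Fin (m i - n i) → Fin (m i))
    (g : (i : Fin k) → Fin (m i - n i) → ZMod (∏ l, p l) → ZMod (∏ l, p l))
    (fcr hcr : Fin (k - 1) → ZMod (∏ l, p l) → ZMod (∏ l, p l))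
    (lam : Fin (k - 1) → ZMod (∏ l, p l)) (x : ℕ) : ZMod (∏ l, p l) :=
  let D : (i : Fin k) → ℕ → ZMod (∏ l, p l) := fun i j => bdigZ p m i x j
  let c : (i : Fin k) → Fin (n i) → ℕ := fun i v => bdig p m i x (J i v)
  (∑ i : Fin k,
      ((((∏ l, p l) / p i : ℕ) : ZMod (∏ l, p l)) *
          (∑ j : Fin (m i - n i - 1),
            F i j (D i (πc c i (Fin.castLE (by omega) j))) *
              F' i j (D i (πc c i
                (Fin.cast (by have := hm i; have := hn i; omega) j.succ)))) +
        ∑ j' : Fin (m i - n i), g i j' (D i (πc c i j')))) +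
    ∑ i' : Fin (k - 1),
      let bi : Fin k := Fin.castLE (by omega) i'
      let bnext : Fin k := Fin.cast (by omega) i'.succ
      lam i' *
        fcr i' (D bi (πc c bi
          ⟨m bi - n bi - 1, by have := hm bi; have := hn bi; omega⟩)) *
        hcr i' (D bnext (πc c bnext
          ⟨0, by have := hm bnext; have := hn bnext; omega⟩))

/-- The code `ψ(C_t)` of Corollary 3, for `0 ≤ t < K = ∏ p_i^{n_i+1}`, writing
`t = t_1 + ∑_{β≥2} t_β ∏_{α<β} p_α^{n_α+1}` with base-`p_u` digits `t_{u,v}` of `t_u`: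
its sequences are indexed by tuples `(d_i, d_{i,n_i+1})_i` and have `x`-th entry
`ξ_q^{f(x) + ∑_i (q/p_i)[(d_i+t_i)·x_{J_i} + d_{i,n_i+1}x_{π_i^c(1)} + t_{i,n_i+1}x_{π_i^c(m_i−n_i)}]}`. -/
noncomputable def psiK (k : ℕ) (hk : 1 ≤ k) (p m n : Fin k → ℕ)
    (hm : ∀ i, 2 ≤ m i) (hn : ∀ i, n i ≤ m i - 1)
    (J : (i : Fin k) → Fin (n i) → Fin (m i))
    (F F' : (i : Fin k) → Fin (m i - n i - 1) → ZMod (∏ l, p l) → ZMod (∏ l, p l))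
    (πc : ((i : Fin k) → Fin (n i) → ℕ) →
      (i : Fin k) → Fin (m i - n i) → Fin (m i))
    (g : (i : Fin k) → Fin (m i - n i) → ZMod (∏ l, p l) → ZMod (∏ l, p l))
    (fcr hcr : Fin (k - 1) → ZMod (∏ l, p l) → ZMod (∏ l, p l))
    (lam : Fin (k - 1) → ZMod (∏ l, p l)) (t : ℕ) :
    ((i : Fin k) → (Fin (n i) → Fin (p i)) × Fin (p i)) → ℕ → ℂ :=
  fun d x =>
    let D : (i : Fin k) → ℕ → ZMod (∏ l, p l) := fun i j => bdigZ p m i x j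
    let c : (i : Fin k) → Fin (n i) → ℕ := fun i v => bdig p m i x (J i v)
    let tc : Fin k → ℕ := fun i =>
      t / (∏ l ∈ Finset.Iio i, p l ^ (n l + 1)) % p i ^ (n i + 1)
    xi (∏ l, p l) ^
      (fK k hk p m n hm hn J F F' πc g fcr hcr lam x +
          ∑ i : Fin k,
            ((((∏ l, p l) / p i : ℕ) : ZMod (∏ l, p l)) *
              ((∑ v : Fin (n i),
                  ((((d i).1 v : ℕ) : ZMod (∏ l, p l)) +
                    ((tc i / p i ^ (v : ℕ) % p i : ℕ) : ZMod (∏ l, p l))) *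
                    D i (J i v)) +
                (((d i).2 : ℕ) : ZMod (∏ l, p l)) *
                  D i (πc c i ⟨0, by have := hm i; have := hn i; omega⟩) +
                ((tc i / p i ^ n i % p i : ℕ) : ZMod (∏ l, p l)) *
                  D i (πc c i
                    ⟨m i - n i - 1, by have := hm i; have := hn i; omega⟩)))).val

open Finset in
theorem sum_pow_mul_div_mod (b σ N : ℕ) :
    ∑ j : Fin N, b ^ (j : ℕ) * (σ / b ^ (j : ℕ) % b) = σ % b ^ N := by
  rw [Fin.sum_univ_eq_sum_range (fun j => b ^ j * (σ / b ^ j % b)) N]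
  induction N with
  | zero => simp [Nat.mod_one]
  | succ N ih => rw [sum_range_succ, ih, Nat.mod_pow_succ]

open Finset in
theorem sum_prod_mul_div_mod {k : ℕ} (P : Fin k → ℕ) (x : ℕ) :
    ∑ i, (∏ l ∈ Iio i, P l) * (x / (∏ l ∈ Iio i, P l) % P i) = x % ∏ i, P i := by
  induction k with
  | zero => simp [Nat.mod_one]
  | succ k ih =>
    have h : ∀ i : Fin k, ∏ l ∈ Iio i.castSucc, P l = ∏ l ∈ Iio i, P l.castSucc := by
      intro i
      rw [← Fin.map_castSuccEmb_Iio, prod_map]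
      rfl
    have h' : ∏ l ∈ Iio (Fin.last k), P l = ∏ l : Fin k, P l.castSucc := by
      rw [Fin.Iio_last_eq_map, prod_map]
      rfl
    rw [Fin.sum_univ_castSucc, Fin.prod_univ_castSucc, Nat.mod_mul, h',
      ← ih (fun l => P l.castSucc)]
    simp only [h]

/-- Digit positions: a block together with a position in it. -/
abbrev Pos {k : ℕ} (m : Fin k → ℕ) : Type := Σ i : Fin k, Fin (m i)

/-- Mixed-radix digit vectors. -/
abbrev Dig {k : ℕ} (p m : Fin k → ℕ) : Type := (l : Pos m) → Fin (p l.1)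

/-- The place value of a digit position. -/
def weight {k : ℕ} (p m : Fin k → ℕ) (l : Pos m) : ℕ :=
  (∏ r ∈ Finset.Iio l.1, p r ^ m r) * p l.1 ^ (l.2 : ℕ)

/-- The number with a given digit vector. -/
def digVal {k : ℕ} (p m : Fin k → ℕ) (x : Dig p m) : ℕ :=
  ∑ l, weight p m l * (x l : ℕ)

/-- The digit vector of a number. -/
def toDig {k : ℕ} {p : Fin k → ℕ} (hp : ∀ i, (p i).Prime) (m : Fin k → ℕ) (x : ℕ) : Dig p m :=
  fun l => ⟨bdig p m l.1 x l.2, Nat.mod_lt _ (hp l.1).pos⟩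

theorem digVal_toDig {k : ℕ} {p : Fin k → ℕ} (hp : ∀ i, (p i).Prime) (m : Fin k → ℕ) (x : ℕ) :
    digVal p m (toDig hp m x) = x % ∏ i, p i ^ m i := by
  rw [← sum_prod_mul_div_mod, digVal, Fintype.sum_sigma]
  refine Finset.sum_congr rfl fun i _ => ?_
  rw [← Nat.mod_mod _ (p i ^ m i), ← sum_pow_mul_div_mod (p i), Finset.mul_sum]
  exact Finset.sum_congr rfl fun j _ => mul_assoc _ _ _

theorem toDig_bijective {k : ℕ} {p : Fin k → ℕ} (hp : ∀ i, (p i).Prime) (m : Fin k → ℕ) :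
    Function.Bijective fun x : Fin (∏ i, p i ^ m i) => toDig hp m x := by
  rw [Fintype.bijective_iff_injective_and_card]
  constructor
  · intro x y h
    have := congrArg (digVal p m) h
    simp only [digVal_toDig] at this
    rwa [Nat.mod_eq_of_lt x.2, Nat.mod_eq_of_lt y.2, Fin.val_inj] at this
  · simp [Fintype.card_pi, Fintype.prod_sigma]

theorem digVal_lt {k : ℕ} {p : Fin k → ℕ} (hp : ∀ i, (p i).Prime) (m : Fin k → ℕ) (x : Dig p m) :
    digVal p m x < ∏ i, p i ^ m i := by
  obtain ⟨y, rfl⟩ := (toDig_bijective hp m).2 x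
  simp only [digVal_toDig]
  exact Nat.mod_lt _ (Finset.prod_pos fun i _ => pow_pos (hp i).pos _)

theorem toDig_digVal {k : ℕ} {p : Fin k → ℕ} (hp : ∀ i, (p i).Prime) (m : Fin k → ℕ)
    (x : Dig p m) : toDig hp m (digVal p m x) = x := by
  obtain ⟨y, rfl⟩ := (toDig_bijective hp m).2 x
  simp only [digVal_toDig, Nat.mod_eq_of_lt y.2]

theorem digVal_injective {k : ℕ} {p : Fin k → ℕ} (hp : ∀ i, (p i).Prime) (m : Fin k → ℕ) :
    Function.Injective (digVal p m) :=
  Function.LeftInverse.injective (toDig_digVal hp m)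

theorem bdig_digVal {k : ℕ} {p : Fin k → ℕ} (hp : ∀ i, (p i).Prime) (m : Fin k → ℕ)
    (x : Dig p m) (i : Fin k) (j : Fin (m i)) : bdig p m i (digVal p m x) j = x ⟨i, j⟩ :=
  congrArg Fin.val (congrFun (toDig_digVal hp m x) ⟨i, j⟩)

theorem sum_range_eq_sum_dig {k : ℕ} {p : Fin k → ℕ} (hp : ∀ i, (p i).Prime) (m : Fin k → ℕ)
    {M : Type*} [AddCommMonoid M] (h : ℕ → M) :
    ∑ x ∈ Finset.range (∏ i, p i ^ m i), h x = ∑ x : Dig p m, h (digVal p m x) := by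
  symm
  refine Finset.sum_nbij (digVal p m) (fun x _ => Finset.mem_range.2 (digVal_lt hp m x))
    ((digVal_injective hp m).injOn) (fun x hx => ⟨toDig hp m x, by simp, ?_⟩) fun _ _ => rfl
  rw [digVal_toDig, Nat.mod_eq_of_lt (by simpa using hx)]

theorem sub_digVal_update {k : ℕ} {p m : Fin k → ℕ} (x y : Dig p m) (l : Pos m)
    (h : x l = y l) (s : Fin (p l.1)) :
    (digVal p m (Function.update y l s) : ℤ) - digVal p m (Function.update x l s)
      = digVal p m y - digVal p m x := by
  simp only [digVal, Nat.cast_sum, ← Finset.sum_sub_distrib]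
  refine Finset.sum_congr rfl fun r _ => ?_
  by_cases hr : r = l
  · subst hr; simp [h]
  · simp [Function.update_of_ne hr]

theorem accf_eq_sum (L : ℕ) (a b : ℕ → ℂ) (τ : ℤ) :
    accf L a b τ = ∑ x ∈ Finset.range L, ∑ y ∈ Finset.range L,
      if (y : ℤ) - x = τ then a x * (starRingEnd ℂ) (b y) else 0 := by
  unfold accf
  rw [← Finset.sum_product', ← Finset.sum_filter]
  split_ifs with h
  · refine Finset.sum_nbij' (fun t => (t, t + τ.toNat)) Prod.fst ?_ ?_ ?_ ?_ ?_
    all_goals simp only [Finset.mem_range, Finset.mem_filter, Finset.mem_product, Prod.forall,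
      Prod.mk.injEq, true_and, implies_true]
    all_goals omega
  · refine Finset.sum_nbij' (fun t => (t + (-τ).toNat, t)) Prod.snd ?_ ?_ ?_ ?_ ?_
    all_goals simp only [Finset.mem_range, Finset.mem_filter, Finset.mem_product, Prod.forall,
      Prod.mk.injEq, and_true, implies_true]
    all_goals omega

theorem xi_pow_val (q : ℕ) [NeZero q] (z : ZMod q) : xi q ^ z.val = ZMod.stdAddChar z := by
  have h := ZMod.stdAddChar_coe (N := q) (z.val : ℤ)
  rw [Int.cast_natCast, ZMod.natCast_zmod_val] at h
  rw [h, xi, ← Complex.exp_nat_mul]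
  congr 1
  push_cast
  ring

theorem stdAddChar_div_mul {q p : ℕ} [NeZero q] [NeZero p] (h : p ∣ q) (z : ZMod q) :
    ZMod.stdAddChar (((q / p : ℕ) : ZMod q) * z) =
      ZMod.stdAddChar (ZMod.castHom h (ZMod p) z) := by
  have hp : (p : ℂ) ≠ 0 := NeZero.ne _
  have hq : (q : ℂ) ≠ 0 := NeZero.ne _
  have hr : (q : ℂ) = p * (q / p : ℕ) := by rw [← Nat.cast_mul, Nat.mul_div_cancel' h]
  generalize q / p = r at hr
  have hz : z = ((z.val : ℤ) : ZMod q) := by simp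
  rw [hz, map_intCast, ZMod.stdAddChar_coe,
    show (r : ZMod q) * ((z.val : ℤ) : ZMod q) = ((r * (z.val : ℤ) : ℤ) : ZMod q) by push_cast; rfl,
    ZMod.stdAddChar_coe]
  congr 1
  push_cast
  field_simp
  rw [hr]
  ring

theorem permutesMod_iff {q p : ℕ} [NeZero q] (h : p ∣ q) (φ : ZMod q → ZMod q) :
    PermutesMod q p φ ↔
      Function.Bijective fun u : Fin p => ZMod.castHom h (ZMod p) (φ ((u : ℕ) : ZMod q)) := by
  simp [PermutesMod, ZMod.natCast_val]

theorem sum_stdAddChar_of_permutesMod {q p : ℕ} [NeZero q] [NeZero p] (h : p ∣ q)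
    {φ : ZMod q → ZMod q} (hφ : PermutesMod q p φ) {δ : ZMod q}
    (hδ : ZMod.castHom h (ZMod p) δ ≠ 0) :
    ∑ u : Fin p, ZMod.stdAddChar (((q / p : ℕ) : ZMod q) * (φ ((u : ℕ) : ZMod q) * δ)) = 0 := by
  simp only [stdAddChar_div_mul h, map_mul]
  rw [((permutesMod_iff h φ).1 hφ).sum_comp
      (fun r => ZMod.stdAddChar (r * ZMod.castHom h (ZMod p) δ)),
    AddChar.sum_mulShift _ (ZMod.isPrimitive_stdAddChar p), if_neg hδ, Nat.cast_zero]

theorem castHom_natCast_injective {q p : ℕ} (h : p ∣ q) :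
    Function.Injective fun u : Fin p => ZMod.castHom h (ZMod p) ((u : ℕ) : ZMod q) := by
  intro u v huv
  simp only [map_natCast, ZMod.natCast_eq_natCast_iff'] at huv
  rwa [Nat.mod_eq_of_lt u.2, Nat.mod_eq_of_lt v.2, Fin.val_inj] at huv

theorem permutesMod_id {q p : ℕ} [NeZero q] [NeZero p] (h : p ∣ q) : PermutesMod q p id := by
  rw [permutesMod_iff h, Fintype.bijective_iff_injective_and_card]
  exact ⟨castHom_natCast_injective h, by simp [ZMod.card]⟩

theorem surjective_of_sum_stdAddChar_eq_zero {p : ℕ} [hp : Fact p.Prime] (f : Fin p → ZMod p)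
    {δ : ZMod p} (hδ : δ ≠ 0) (hf : ∑ u, ZMod.stdAddChar (f u * δ) = 0) :
    Function.Surjective f := by
  have hδ1 : ZMod.stdAddChar δ ≠ 1 := fun h =>
    hδ (ZMod.injective_stdAddChar (h.trans (AddChar.map_zero_eq_one _).symm))
  have hpow : ∀ a : ZMod p, ZMod.stdAddChar (a * δ) = (ZMod.stdAddChar δ) ^ a.val := fun a => by
    rw [← AddChar.map_nsmul_eq_pow, nsmul_eq_mul, ZMod.natCast_zmod_val]
  have hprim : IsPrimitiveRoot (ZMod.stdAddChar δ) p := by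
    refine IsPrimitiveRoot.iff_orderOf.2 (orderOf_eq_prime ?_ hδ1)
    rw [← AddChar.map_nsmul_eq_pow, nsmul_eq_mul, CharP.cast_eq_zero, zero_mul,
      AddChar.map_zero_eq_one]
  let P : Polynomial ℚ := ∑ u, Polynomial.X ^ (f u).val
  have hroot : Polynomial.aeval (ZMod.stdAddChar δ) P = 0 := by
    simpa only [P, map_sum, map_pow, Polynomial.aeval_X, ← hpow] using hf
  have hdvd : Polynomial.cyclotomic p ℚ ∣ P := by
    rw [Polynomial.cyclotomic_eq_minpoly_rat hprim hp.out.pos]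
    exact minpoly.dvd _ _ hroot
  obtain ⟨C, hC⟩ := hdvd
  have hdegP : P.natDegree ≤ p - 1 := by
    refine Polynomial.natDegree_sum_le_of_forall_le _ _ fun u _ => ?_
    rw [Polynomial.natDegree_X_pow]
    exact Nat.le_sub_one_of_lt (ZMod.val_lt _)
  have hP1 : P.eval 1 = p := by simp [P, Polynomial.eval_finsetSum]
  have hC0 : C ≠ 0 := by
    rintro rfl
    rw [mul_zero] at hC
    rw [hC, Polynomial.eval_zero] at hP1
    exact hp.out.ne_zero (by exact_mod_cast hP1.symm)
  have hdegC : C.natDegree = 0 := by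
    have := Polynomial.natDegree_mul (Polynomial.cyclotomic_ne_zero p ℚ) hC0
    rw [← hC, Polynomial.natDegree_cyclotomic, Nat.totient_prime hp.out] at this
    omega
  obtain ⟨c, rfl⟩ : ∃ c, C = Polynomial.C c := ⟨_, Polynomial.eq_C_of_natDegree_eq_zero hdegC⟩
  intro r
  have hcoeff : P.coeff r.val = c := by
    rw [hC, Polynomial.coeff_mul_C, Polynomial.cyclotomic_prime,
      Polynomial.finsetSum_coeff]
    simp [Polynomial.coeff_X_pow, ZMod.val_lt]
  by_contra! hr
  refine hC0 ?_
  rw [← hcoeff, Polynomial.finsetSum_coeff, Finset.sum_eq_zero, Polynomial.C_0]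
  intro u _
  rw [Polynomial.coeff_X_pow, if_neg]
  exact fun h => hr u (ZMod.val_injective _ h.symm)

theorem permutesMod_of_sum_eq_zero {q p : ℕ} [NeZero q] (hp : p.Prime) (h : p ∣ q)
    (φ φ' : ZMod q → ZMod q)
    (H : ∀ α β : Fin p, α ≠ β →
      ∑ u : Fin p, ZMod.stdAddChar (((q / p : ℕ) : ZMod q) *
        (φ ((u : ℕ) : ZMod q) * (φ' ((α : ℕ) : ZMod q) - φ' ((β : ℕ) : ZMod q)))) = 0) :
    PermutesMod q p φ ∧ PermutesMod q p φ' := by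
  have : Fact p.Prime := ⟨hp⟩
  simp only [stdAddChar_div_mul h, map_mul] at H
  have hinj : Function.Injective
      fun u : Fin p => ZMod.castHom h (ZMod p) (φ' ((u : ℕ) : ZMod q)) := by
    intro α β hαβ
    by_contra hne
    have := H α β hne
    simp only at hαβ
    rw [map_sub, hαβ] at this
    simp [hp.ne_zero] at this
  rw [permutesMod_iff h, permutesMod_iff h]
  constructor
  · rw [Fintype.bijective_iff_surjective_and_card]
    refine ⟨?_, by simp [ZMod.card]⟩
    have hne : (⟨0, hp.pos⟩ : Fin p) ≠ ⟨1, hp.one_lt⟩ := by simp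
    refine surjective_of_sum_stdAddChar_eq_zero _ ?_ (H _ _ hne)
    rw [map_sub, sub_ne_zero]
    exact hinj.ne hne
  · rw [Fintype.bijective_iff_injective_and_card]
    exact ⟨hinj, by simp [ZMod.card]⟩

theorem stdAddChar_sum {q : ℕ} [NeZero q] {ι : Type*} (s : Finset ι) (f : ι → ZMod q) :
    ZMod.stdAddChar (∑ i ∈ s, f i) = ∏ i ∈ s, ZMod.stdAddChar (f i) := by
  induction s using Finset.induction_on with
  | empty => simp
  | insert a s ha ih =>
    rw [Finset.sum_insert ha, Finset.prod_insert ha, AddChar.map_add_eq_mul, ih]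

section Codes

variable {k : ℕ} {p m n : Fin k → ℕ}

/-- The coupling terms of `fK` along the paths, as a function of the path coordinates `X`. -/
def coupling (p m n : Fin k → ℕ) (hm : ∀ i, 2 ≤ m i) (hn : ∀ i, n i ≤ m i - 1)
    (F F' : (i : Fin k) → Fin (m i - n i - 1) → ZMod (∏ l, p l) → ZMod (∏ l, p l))
    (X : (i : Fin k) → Fin (m i - n i) → ZMod (∏ l, p l)) : ZMod (∏ l, p l) :=
  ∑ i : Fin k, (((∏ l, p l) / p i : ℕ) : ZMod (∏ l, p l)) *
    ∑ j : Fin (m i - n i - 1),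
      F i j (X i (Fin.castLE (by omega) j)) *
        F' i j (X i (Fin.cast (by have := hm i; have := hn i; omega) j.succ))

/-- The one-coordinate terms of `fK`. -/
def diagonal (p m n : Fin k → ℕ)
    (g : (i : Fin k) → Fin (m i - n i) → ZMod (∏ l, p l) → ZMod (∏ l, p l))
    (X : (i : Fin k) → Fin (m i - n i) → ZMod (∏ l, p l)) : ZMod (∏ l, p l) :=
  ∑ i : Fin k, ∑ j : Fin (m i - n i), g i j (X i j)

/-- The terms of `fK` linking consecutive blocks. -/
def linking (hk : 1 ≤ k) (p m n : Fin k → ℕ) (hm : ∀ i, 2 ≤ m i) (hn : ∀ i, n i ≤ m i - 1)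
    (fcr hcr : Fin (k - 1) → ZMod (∏ l, p l) → ZMod (∏ l, p l))
    (lam : Fin (k - 1) → ZMod (∏ l, p l))
    (X : (i : Fin k) → Fin (m i - n i) → ZMod (∏ l, p l)) : ZMod (∏ l, p l) :=
  ∑ i' : Fin (k - 1),
    let bi : Fin k := Fin.castLE (by omega) i'
    let bnext : Fin k := Fin.cast (by omega) i'.succ
    lam i' *
      fcr i' (X bi ⟨m bi - n bi - 1, by have := hm bi; have := hn bi; omega⟩) *
      hcr i' (X bnext ⟨0, by have := hm bnext; have := hn bnext; omega⟩)

/-- The restricted coordinates of a digit vector. -/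
def restr (J : (i : Fin k) → Fin (n i) → Fin (m i)) (x : Dig p m) :
    (i : Fin k) → Fin (n i) → ℕ := fun i v => x ⟨i, J i v⟩

/-- The position of the `a`-th vertex of the path of block `i` at the digit vector `x`. -/
def pathPos (J : (i : Fin k) → Fin (n i) → Fin (m i))
    (πc : ((i : Fin k) → Fin (n i) → ℕ) → (i : Fin k) → Fin (m i - n i) → Fin (m i))
    (x : Dig p m) (i : Fin k) (a : Fin (m i - n i)) : Pos m := ⟨i, πc (restr J x) i a⟩

/-- The path coordinates of a digit vector. -/
def pathCoord (J : (i : Fin k) → Fin (n i) → Fin (m i))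
    (πc : ((i : Fin k) → Fin (n i) → ℕ) → (i : Fin k) → Fin (m i - n i) → Fin (m i))
    (x : Dig p m) (i : Fin k) (a : Fin (m i - n i)) : ZMod (∏ l, p l) :=
  ((x (pathPos J πc x i a) : ℕ) : ZMod (∏ l, p l))

/-- The terms of the exponent of `psiK` that depend on the code index `t`. -/
def shiftTerm (p m n : Fin k → ℕ) (hm : ∀ i, 2 ≤ m i) (hn : ∀ i, n i ≤ m i - 1)
    (J : (i : Fin k) → Fin (n i) → Fin (m i))
    (πc : ((i : Fin k) → Fin (n i) → ℕ) → (i : Fin k) → Fin (m i - n i) → Fin (m i))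
    (t : ℕ) (x : Dig p m) : ZMod (∏ l, p l) :=
  ∑ i : Fin k, (((∏ l, p l) / p i : ℕ) : ZMod (∏ l, p l)) *
    ((∑ v : Fin (n i), ((bdig p (fun i => n i + 1) i t v : ℕ) : ZMod (∏ l, p l)) *
        ((x ⟨i, J i v⟩ : ℕ) : ZMod (∏ l, p l))) +
      ((bdig p (fun i => n i + 1) i t (n i) : ℕ) : ZMod (∏ l, p l)) *
        pathCoord J πc x i ⟨m i - n i - 1, by have := hm i; have := hn i; omega⟩)

/-- The part of the exponent of `psiK` that does not depend on the sequence index. -/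
def phase (hk : 1 ≤ k) (p m n : Fin k → ℕ) (hm : ∀ i, 2 ≤ m i) (hn : ∀ i, n i ≤ m i - 1)
    (J : (i : Fin k) → Fin (n i) → Fin (m i))
    (F F' : (i : Fin k) → Fin (m i - n i - 1) → ZMod (∏ l, p l) → ZMod (∏ l, p l))
    (πc : ((i : Fin k) → Fin (n i) → ℕ) → (i : Fin k) → Fin (m i - n i) → Fin (m i))
    (g : (i : Fin k) → Fin (m i - n i) → ZMod (∏ l, p l) → ZMod (∏ l, p l))
    (fcr hcr : Fin (k - 1) → ZMod (∏ l, p l) → ZMod (∏ l, p l))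
    (lam : Fin (k - 1) → ZMod (∏ l, p l)) (t : ℕ) (x : Dig p m) : ZMod (∏ l, p l) :=
  coupling p m n hm hn F F' (pathCoord J πc x) + diagonal p m n g (pathCoord J πc x) +
    linking hk p m n hm hn fcr hcr lam (pathCoord J πc x) + shiftTerm p m n hm hn J πc t x

theorem fK_digVal (hk : 1 ≤ k) (hp : ∀ i, (p i).Prime) (hm : ∀ i, 2 ≤ m i)
    (hn : ∀ i, n i ≤ m i - 1) (J : (i : Fin k) → Fin (n i) → Fin (m i))
    (F F' : (i : Fin k) → Fin (m i - n i - 1) → ZMod (∏ l, p l) → ZMod (∏ l, p l))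
    (πc : ((i : Fin k) → Fin (n i) → ℕ) → (i : Fin k) → Fin (m i - n i) → Fin (m i))
    (g : (i : Fin k) → Fin (m i - n i) → ZMod (∏ l, p l) → ZMod (∏ l, p l))
    (fcr hcr : Fin (k - 1) → ZMod (∏ l, p l) → ZMod (∏ l, p l))
    (lam : Fin (k - 1) → ZMod (∏ l, p l)) (x : Dig p m) :
    fK k hk p m n hm hn J F F' πc g fcr hcr lam (digVal p m x) =
      coupling p m n hm hn F F' (pathCoord J πc x) + diagonal p m n g (pathCoord J πc x) +
        linking hk p m n hm hn fcr hcr lam (pathCoord J πc x) := by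
  simp only [fK, coupling, diagonal, linking, bdigZ, bdig_digVal hp, ← Finset.sum_add_distrib]
  rfl

theorem psiK_digVal [NeZero (∏ l, p l)] (hk : 1 ≤ k) (hp : ∀ i, (p i).Prime) (hm : ∀ i, 2 ≤ m i)
    (hn : ∀ i, n i ≤ m i - 1) (J : (i : Fin k) → Fin (n i) → Fin (m i))
    (F F' : (i : Fin k) → Fin (m i - n i - 1) → ZMod (∏ l, p l) → ZMod (∏ l, p l))
    (πc : ((i : Fin k) → Fin (n i) → ℕ) → (i : Fin k) → Fin (m i - n i) → Fin (m i))
    (g : (i : Fin k) → Fin (m i - n i) → ZMod (∏ l, p l) → ZMod (∏ l, p l))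
    (fcr hcr : Fin (k - 1) → ZMod (∏ l, p l) → ZMod (∏ l, p l))
    (lam : Fin (k - 1) → ZMod (∏ l, p l)) (t : ℕ)
    (d : (i : Fin k) → (Fin (n i) → Fin (p i)) × Fin (p i)) (x : Dig p m) :
    psiK k hk p m n hm hn J F F' πc g fcr hcr lam t d (digVal p m x) =
      ZMod.stdAddChar (phase hk p m n hm hn J F F' πc g fcr hcr lam t x +
        ∑ i : Fin k, (((∏ l, p l) / p i : ℕ) : ZMod (∏ l, p l)) *
          ((∑ v : Fin (n i), (((d i).1 v : ℕ) : ZMod (∏ l, p l)) *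
              ((x ⟨i, J i v⟩ : ℕ) : ZMod (∏ l, p l))) +
            (((d i).2 : ℕ) : ZMod (∏ l, p l)) *
              pathCoord J πc x i ⟨0, by have := hm i; have := hn i; omega⟩)) := by
  rw [psiK, xi_pow_val, fK_digVal hk hp, phase, shiftTerm, add_assoc _ (∑ i : Fin k, _)
    (∑ i : Fin k, _), ← Finset.sum_add_distrib]
  congr 2
  refine Finset.sum_congr rfl fun i _ => ?_
  rw [← mul_add]
  congr 1
  simp only [bdigZ, bdig_digVal hp, add_mul, Finset.sum_add_distrib]
  simp only [bdig, pathCoord, pathPos]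
  unfold restr
  ring

theorem sum_stdAddChar_index [NeZero (∏ l, p l)] (hp : ∀ i, (p i).Prime)
    (z : (i : Fin k) → Fin (n i) → ZMod (∏ l, p l)) (w : Fin k → ZMod (∏ l, p l)) :
    ∑ d : (i : Fin k) → (Fin (n i) → Fin (p i)) × Fin (p i),
      ZMod.stdAddChar (∑ i : Fin k, (((∏ l, p l) / p i : ℕ) : ZMod (∏ l, p l)) *
        ((∑ v : Fin (n i), (((d i).1 v : ℕ) : ZMod (∏ l, p l)) * z i v) +
          (((d i).2 : ℕ) : ZMod (∏ l, p l)) * w i)) =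
    if (∀ i v, ZMod.castHom (Finset.dvd_prod_of_mem p (Finset.mem_univ i)) (ZMod (p i)) (z i v) = 0)
      ∧ ∀ i, ZMod.castHom (Finset.dvd_prod_of_mem p (Finset.mem_univ i)) (ZMod (p i)) (w i) = 0
    then ((∏ i, p i ^ (n i + 1) : ℕ) : ℂ) else 0 := by
  have : ∀ i, NeZero (p i) := fun i => ⟨(hp i).ne_zero⟩
  have hd : ∀ i, p i ∣ ∏ l, p l := fun i => Finset.dvd_prod_of_mem p (Finset.mem_univ i)
  have key : ∀ i (a : ZMod (∏ l, p l)), ∑ u : Fin (p i),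
      ZMod.stdAddChar ((((∏ l, p l) / p i : ℕ) : ZMod (∏ l, p l)) *
        (((u : ℕ) : ZMod (∏ l, p l)) * a)) =
      if ZMod.castHom (hd i) (ZMod (p i)) a = 0 then (p i : ℂ) else 0 := by
    intro i a
    split_ifs with h
    · simp [stdAddChar_div_mul (hd i), map_mul, h]
    · exact sum_stdAddChar_of_permutesMod (hd i) (permutesMod_id (hd i)) h
  simp only [mul_add, Finset.mul_sum, stdAddChar_sum, AddChar.map_add_eq_mul]
  rw [← Fintype.piFinset_univ, ← Finset.prod_univ_sum (fun _ => Finset.univ)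
    (fun i (e : (Fin (n i) → Fin (p i)) × Fin (p i)) => (∏ v,
      (ZMod.stdAddChar ((((∏ l, p l) / p i : ℕ) : ZMod (∏ l, p l)) *
        (((e.1 v : ℕ) : ZMod (∏ l, p l)) * z i v)) : ℂ)) *
      ZMod.stdAddChar ((((∏ l, p l) / p i : ℕ) : ZMod (∏ l, p l)) *
        (((e.2 : ℕ) : ZMod (∏ l, p l)) * w i)))]
  have : ∀ i, ∑ e : (Fin (n i) → Fin (p i)) × Fin (p i), (∏ v,
      (ZMod.stdAddChar ((((∏ l, p l) / p i : ℕ) : ZMod (∏ l, p l)) *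
        (((e.1 v : ℕ) : ZMod (∏ l, p l)) * z i v)) : ℂ)) *
      ZMod.stdAddChar ((((∏ l, p l) / p i : ℕ) : ZMod (∏ l, p l)) *
        (((e.2 : ℕ) : ZMod (∏ l, p l)) * w i)) =
      (∏ v, if ZMod.castHom (hd i) (ZMod (p i)) (z i v) = 0 then (p i : ℂ) else 0) *
        if ZMod.castHom (hd i) (ZMod (p i)) (w i) = 0 then (p i : ℂ) else 0 := by
    intro i
    rw [Fintype.sum_prod_type]
    simp only [← key]
    rw [Finset.prod_univ_sum, Fintype.piFinset_univ, Finset.sum_mul_sum]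
  simp only [this]
  split_ifs with h
  · simp [h.1, h.2, pow_succ]
  · rw [not_and_or] at h
    push Not at h
    rcases h with ⟨i, v, h⟩ | ⟨i, h⟩
    · refine Finset.prod_eq_zero (Finset.mem_univ i) ?_
      rw [Finset.prod_eq_zero (Finset.mem_univ v) (if_neg h), zero_mul]
    · refine Finset.prod_eq_zero (Finset.mem_univ i) ?_
      rw [if_neg h, mul_zero]

theorem castHom_natCast_sub_eq_zero {q r : ℕ} (h : r ∣ q) (a b : Fin r) :
    ZMod.castHom h (ZMod r) (((a : ℕ) : ZMod q) - ((b : ℕ) : ZMod q)) = 0 ↔ a = b := by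
  have : NeZero r := ⟨(Fin.pos a).ne'⟩
  rw [map_sub, sub_eq_zero]
  exact (castHom_natCast_injective h).eq_iff

/-- Two digit vectors agree at the restricted positions and at the initial vertex of each path. -/
def Matched (hm : ∀ i, 2 ≤ m i) (hn : ∀ i, n i ≤ m i - 1)
    (J : (i : Fin k) → Fin (n i) → Fin (m i))
    (πc : ((i : Fin k) → Fin (n i) → ℕ) → (i : Fin k) → Fin (m i - n i) → Fin (m i))
    (x y : Dig p m) : Prop :=
  (∀ i v, x ⟨i, J i v⟩ = y ⟨i, J i v⟩) ∧
    ∀ i, x ⟨i, πc (restr J x) i ⟨0, by have := hm i; have := hn i; omega⟩⟩ =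
      y ⟨i, πc (restr J y) i ⟨0, by have := hm i; have := hn i; omega⟩⟩

theorem codeACCF_psiK [NeZero (∏ l, p l)] (hk : 1 ≤ k) (hp : ∀ i, (p i).Prime)
    (hm : ∀ i, 2 ≤ m i) (hn : ∀ i, n i ≤ m i - 1) (J : (i : Fin k) → Fin (n i) → Fin (m i))
    (F F' : (i : Fin k) → Fin (m i - n i - 1) → ZMod (∏ l, p l) → ZMod (∏ l, p l))
    (πc : ((i : Fin k) → Fin (n i) → ℕ) → (i : Fin k) → Fin (m i - n i) → Fin (m i))
    (g : (i : Fin k) → Fin (m i - n i) → ZMod (∏ l, p l) → ZMod (∏ l, p l))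
    (fcr hcr : Fin (k - 1) → ZMod (∏ l, p l) → ZMod (∏ l, p l))
    (lam : Fin (k - 1) → ZMod (∏ l, p l)) (t t' : ℕ) (τ : ℤ) :
    codeACCF (∏ i, p i ^ m i) (psiK k hk p m n hm hn J F F' πc g fcr hcr lam t)
        (psiK k hk p m n hm hn J F F' πc g fcr hcr lam t') τ =
      ((∏ i, p i ^ (n i + 1) : ℕ) : ℂ) * ∑ a : Dig p m × Dig p m with
        (digVal p m a.2 : ℤ) - digVal p m a.1 = τ ∧ Matched hm hn J πc a.1 a.2,
        ZMod.stdAddChar (phase hk p m n hm hn J F F' πc g fcr hcr lam t a.1 -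
          phase hk p m n hm hn J F F' πc g fcr hcr lam t' a.2) := by
  simp only [codeACCF, accf_eq_sum, sum_range_eq_sum_dig hp, psiK_digVal hk hp]
  simp only [← Fintype.sum_prod_type'
    (f := fun x y : Dig p m => if (digVal p m y : ℤ) - digVal p m x = τ then
      (ZMod.stdAddChar _ : ℂ) * _ else 0)]
  rw [Finset.sum_comm, Finset.mul_sum, Finset.sum_filter]
  refine Finset.sum_congr rfl fun a _ => ?_
  by_cases hτ : (digVal p m a.2 : ℤ) - digVal p m a.1 = τ
  swap
  · simp [hτ]
  simp only [hτ, if_true, true_and, ← AddChar.map_neg_eq_conj, ← AddChar.map_add_eq_mul]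
  have h := (sum_stdAddChar_index (n := n) hp
    (fun i v => ((a.1 ⟨i, J i v⟩ : ℕ) : ZMod (∏ l, p l)) - ((a.2 ⟨i, J i v⟩ : ℕ) : ZMod (∏ l, p l)))
    (fun i => pathCoord J πc a.1 i ⟨0, by have := hm i; have := hn i; omega⟩ -
      pathCoord J πc a.2 i ⟨0, by have := hm i; have := hn i; omega⟩)).trans
    (if_congr (Q := Matched hm hn J πc a.1 a.2)
      (and_congr (forall₂_congr fun i v => castHom_natCast_sub_eq_zero _ _ _)
        (forall_congr' fun i => castHom_natCast_sub_eq_zero _ _ _)) rfl rfl)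
  rw [← ite_zero_mul]
  refine Eq.trans ?_ (congrArg (· * _) h)
  rw [Finset.sum_mul]
  refine Finset.sum_congr rfl fun d _ => ?_
  rw [← AddChar.map_add_eq_mul]
  congr 1
  simp only [mul_sub, mul_add, Finset.sum_sub_distrib, Finset.sum_add_distrib, pathCoord]
  ring

end Codes

section Sufficiency

variable {k : ℕ} {p m n : Fin k → ℕ}

theorem sum_pairs_eq_zero (hp : ∀ i, (p i).Prime) (S : Finset (Dig p m × Dig p m))
    (P : Dig p m × Dig p m → Pos m) (G : Dig p m × Dig p m → ℂ)
    (hS : ∀ a ∈ S, a.1 (P a) = a.2 (P a))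
    (hmem : ∀ a ∈ S, ∀ s, (Function.update a.1 (P a) s, Function.update a.2 (P a) s) ∈ S)
    (hP : ∀ a ∈ S, ∀ s, P (Function.update a.1 (P a) s, Function.update a.2 (P a) s) = P a)
    (hG : ∀ a ∈ S, ∑ s, G (Function.update a.1 (P a) s, Function.update a.2 (P a) s) = 0) :
    ∑ a ∈ S, G a = 0 := by
  rw [← Finset.sum_fiberwise S P]
  refine Finset.sum_eq_zero fun l _ => ?_
  have h : ∑ b ∈ {a ∈ S | P a = l} ×ˢ (Finset.univ : Finset (Fin (p l.1))), G b.1 =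
      ∑ b ∈ {a ∈ S | P a = l} ×ˢ (Finset.univ : Finset (Fin (p l.1))),
        G (Function.update b.1.1 l b.2, Function.update b.1.2 l b.2) := by
    refine Finset.sum_nbij'
      (fun b => ((Function.update b.1.1 l b.2, Function.update b.1.2 l b.2), b.1.1 l))
      (fun b => ((Function.update b.1.1 l b.2, Function.update b.1.2 l b.2), b.1.1 l))
      ?_ ?_ ?_ ?_ ?_
    all_goals
      rintro ⟨a, s⟩ hb
      obtain ⟨ha, rfl⟩ : a ∈ S ∧ P a = l := by simpa using hb
      have hself : Function.update a.1 (P a) (a.2 (P a)) = a.1 := by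
        rw [← hS a ha, Function.update_eq_self]
    · simpa using ⟨hmem a ha s, hP a ha s⟩
    · simpa using ⟨hmem a ha s, hP a ha s⟩
    · simp [hS a ha, hself]
    · simp [hS a ha, hself]
    · simp [hS a ha, hself]
  rw [Finset.sum_product, Finset.sum_product] at h
  simp only [Finset.sum_const, Finset.card_univ, Fintype.card_fin, nsmul_eq_mul,
    ← Finset.mul_sum] at h
  rw [Finset.sum_eq_zero (s := {a ∈ S | P a = l}) (f := fun a => ∑ s, _)] at h
  · exact (mul_eq_zero.1 h).resolve_left (Nat.cast_ne_zero.2 (hp l.1).ne_zero)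
  · intro a ha
    obtain ⟨haS, rfl⟩ : a ∈ S ∧ P a = l := by simpa using ha
    exact hG a haS

theorem sum_stdAddChar_affine {q r : ℕ} [NeZero q] [NeZero r] (h : r ∣ q)
    {φ : ZMod q → ZMod q} (hφ : PermutesMod q r φ) {δ : ZMod q}
    (hδ : ZMod.castHom h (ZMod r) δ ≠ 0) (C b : ZMod q) :
    ∑ u : Fin r, ZMod.stdAddChar
      (C + ((q / r : ℕ) : ZMod q) * ((φ ((u : ℕ) : ZMod q) - b) * δ)) = 0 := by
  rw [← mul_zero (ZMod.stdAddChar (C - ((q / r : ℕ) : ZMod q) * (b * δ)) : ℂ),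
    ← sum_stdAddChar_of_permutesMod h hφ hδ, Finset.mul_sum]
  refine Finset.sum_congr rfl fun u _ => ?_
  rw [← AddChar.map_add_eq_mul]
  congr 1
  ring

theorem coupling_sub (hm : ∀ i, 2 ≤ m i) (hn : ∀ i, n i ≤ m i - 1)
    (F F' : (i : Fin k) → Fin (m i - n i - 1) → ZMod (∏ l, p l) → ZMod (∏ l, p l))
    (X Y X' Y' : (i : Fin k) → Fin (m i - n i) → ZMod (∏ l, p l)) (i : Fin k)
    (j : Fin (m i - n i - 1))
    (h : ∀ i' (a b : Fin (m i' - n i')) (e : Fin (m i' - n i' - 1)), (a : ℕ) = e → (b : ℕ) = e + 1 →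
      (i' ≠ i ∨ (e : ℕ) ≠ j) →
      F i' e (X' i' a) * F' i' e (X' i' b) - F i' e (Y' i' a) * F' i' e (Y' i' b) =
        F i' e (X i' a) * F' i' e (X i' b) - F i' e (Y i' a) * F' i' e (Y i' b))
    (a b : Fin (m i - n i)) (ha : (a : ℕ) = j) (hb : (b : ℕ) = j + 1) :
    coupling p m n hm hn F F' X' - coupling p m n hm hn F F' Y' =
      coupling p m n hm hn F F' X - coupling p m n hm hn F F' Y +
        (((∏ l, p l) / p i : ℕ) : ZMod (∏ l, p l)) *
          (F i j (X' i a) * F' i j (X' i b) - F i j (Y' i a) * F' i j (Y' i b) -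
            (F i j (X i a) * F' i j (X i b) - F i j (Y i a) * F' i j (Y i b))) := by
  obtain rfl : a = Fin.castLE (Nat.sub_le _ _) j := Fin.ext ha
  have hpos : m i - n i - 1 + 1 = m i - n i := by
    have := hm i
    have := hn i
    omega
  obtain rfl : b = Fin.cast hpos j.succ := Fin.ext hb
  rw [← sub_eq_iff_eq_add']
  simp only [coupling, ← Finset.sum_sub_distrib, ← mul_sub]
  rw [Finset.sum_eq_single i, Finset.sum_eq_single j]
  · intro e _ he
    rw [sub_eq_zero]
    exact h i _ _ e rfl rfl (Or.inr (Fin.val_ne_of_ne he))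
  · simp
  · intro i' _ hi'
    rw [Finset.sum_eq_zero, mul_zero]
    intro e _
    rw [sub_eq_zero]
    exact h i' _ _ e rfl rfl (Or.inl hi')
  · simp

theorem diagonal_sub (g : (i : Fin k) → Fin (m i - n i) → ZMod (∏ l, p l) → ZMod (∏ l, p l))
    (X Y X' Y' : (i : Fin k) → Fin (m i - n i) → ZMod (∏ l, p l))
    (h : ∀ i a, (X' i a = X i a ∧ Y' i a = Y i a) ∨ (X i a = Y i a ∧ X' i a = Y' i a)) :
    diagonal p m n g X' - diagonal p m n g Y' = diagonal p m n g X - diagonal p m n g Y := by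
  simp only [diagonal, ← Finset.sum_sub_distrib]
  refine Finset.sum_congr rfl fun i _ => Finset.sum_congr rfl fun a _ => ?_
  rcases h i a with ⟨h₁, h₂⟩ | ⟨h₁, h₂⟩ <;> rw [h₁, h₂]
  rw [sub_self, sub_self]

theorem linking_sub (hk : 1 ≤ k) (hm : ∀ i, 2 ≤ m i) (hn : ∀ i, n i ≤ m i - 1)
    (fcr hcr : Fin (k - 1) → ZMod (∏ l, p l) → ZMod (∏ l, p l))
    (lam : Fin (k - 1) → ZMod (∏ l, p l))
    (X Y X' Y' : (i : Fin k) → Fin (m i - n i) → ZMod (∏ l, p l)) (i : Fin k)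
    (j : Fin (m i - n i - 1))
    (hne : ∀ i' (a : Fin (m i' - n i')), i' ≠ i ∨ (a : ℕ) ≠ j →
      X' i' a = X i' a ∧ Y' i' a = Y i' a)
    (hlt : ∀ i' (a : Fin (m i' - n i')), i' < i ∨ i' = i ∧ (a : ℕ) ≤ j →
      X i' a = Y i' a ∧ X' i' a = Y' i' a) :
    linking hk p m n hm hn fcr hcr lam X' - linking hk p m n hm hn fcr hcr lam Y' =
      linking hk p m n hm hn fcr hcr lam X - linking hk p m n hm hn fcr hcr lam Y := by
  simp only [linking, ← Finset.sum_sub_distrib]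
  refine Finset.sum_congr rfl fun i' _ => ?_
  by_cases h : (Fin.cast (by omega) i'.succ : Fin k) = i ∧ (j : ℕ) = 0
  · have hi : (Fin.castLE (by omega) i' : Fin k) < i :=
      lt_of_lt_of_eq (by simp [Fin.lt_def]) h.1
    rw [(hlt _ _ (Or.inl hi)).1, (hlt _ _ (Or.inl hi)).2,
      (hlt _ _ (Or.inr ⟨h.1, Nat.zero_le _⟩)).1, (hlt _ _ (Or.inr ⟨h.1, Nat.zero_le _⟩)).2,
      sub_self, sub_self]
  · have h₁ : (Fin.cast (by omega) i'.succ : Fin k) ≠ i ∨ 0 ≠ (j : ℕ) := by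
      rw [not_and_or] at h
      exact h.imp_right Ne.symm
    have h₂ : (Fin.castLE (by omega) i' : Fin k) ≠ i ∨
        m (Fin.castLE (by omega) i' : Fin k) - n (Fin.castLE (by omega) i' : Fin k) - 1 ≠ j := by
      by_cases hi : (Fin.castLE (by omega) i' : Fin k) = i
      · right
        have := j.2
        rw [hi]
        omega
      · exact Or.inl hi
    have e₁ := hne (Fin.cast (by omega) i'.succ)
      ⟨0, by have := hm (Fin.cast (by omega) i'.succ); have := hn (Fin.cast (by omega) i'.succ)
             omega⟩ h₁
    have e₂ := hne (Fin.castLE (by omega) i')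
      ⟨_, by have := hm (Fin.castLE (by omega) i'); have := hn (Fin.castLE (by omega) i'); omega⟩ h₂
    rw [e₁.1, e₁.2, e₂.1, e₂.2]

end Sufficiency

section Fork

variable {k : ℕ} {p m n : Fin k → ℕ} {J : (i : Fin k) → Fin (n i) → Fin (m i)}
  {πc : ((i : Fin k) → Fin (n i) → ℕ) → (i : Fin k) → Fin (m i - n i) → Fin (m i)}

theorem eq_restricted_or_eq_path {r s : ℕ} (hrs : r ≤ s) {J : Fin r → Fin s}
    {π : Fin (s - r) → Fin s} (hJ : Function.Injective J) (hπ : Function.Injective π)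
    (hd : ∀ a b, π a ≠ J b) (x : Fin s) : (∃ v, J v = x) ∨ ∃ a, π a = x := by
  have hinj : Function.Injective (Sum.elim J π) :=
    hJ.sumElim hπ fun v a h => hd a v h.symm
  have hsurj := ((Fintype.bijective_iff_injective_and_card _).2
    ⟨hinj, by simp [hrs]⟩).2 x
  obtain ⟨v | a, h⟩ := hsurj
  · exact Or.inl ⟨v, h⟩
  · exact Or.inr ⟨a, h⟩

theorem restr_update (x : Dig p m) {l : Pos m} (hl : ∀ i v, (⟨i, J i v⟩ : Pos m) ≠ l)
    (s : Fin (p l.1)) : restr J (Function.update x l s) = restr J x := by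
  funext i v
  simp only [restr, Function.update_of_ne (hl i v)]

theorem restricted_ne_pathPos (hπ : ∀ c i, ∀ a b, πc c i a ≠ J i b) (x : Dig p m) (i : Fin k)
    (a : Fin (m i - n i)) (i' : Fin k) (v : Fin (n i')) :
    (⟨i', J i' v⟩ : Pos m) ≠ pathPos J πc x i a := by
  intro h
  obtain ⟨rfl, h⟩ := Sigma.mk.inj_iff.1 h
  exact hπ _ _ _ _ (eq_of_heq h).symm

theorem pathPos_congr {x y : Dig p m} (h : restr J x = restr J y) (i : Fin k)
    (a : Fin (m i - n i)) : pathPos J πc x i a = pathPos J πc y i a := by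
  rw [pathPos, pathPos, h]

theorem pathPos_ne (hπ : ∀ c i, Function.Injective (πc c i)) (x : Dig p m) {i i' : Fin k}
    {a : Fin (m i - n i)} {b : Fin (m i' - n i')} (h : i ≠ i' ∨ (a : ℕ) ≠ b) :
    pathPos J πc x i a ≠ pathPos J πc x i' b := by
  intro hab
  obtain ⟨rfl, hab⟩ := Sigma.mk.inj_iff.1 hab
  rcases h with h | h
  · exact h rfl
  · exact h (congrArg Fin.val (hπ _ _ (eq_of_heq hab)))

theorem update_apply_eq_of_eq {x y : Dig p m} (l : Pos m) (s : Fin (p l.1)) {l' : Pos m}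
    (h : x l' = y l') : Function.update x l s l' = Function.update y l s l' := by
  by_cases hl : l' = l
  · subst hl
    simp
  · simpa [hl] using h

theorem matched_iff (hm : ∀ i, 2 ≤ m i) (hn : ∀ i, n i ≤ m i - 1) (x y : Dig p m) :
    Matched hm hn J πc x y ↔ restr J x = restr J y ∧
      ∀ i, x (pathPos J πc x i ⟨0, by have := hm i; have := hn i; omega⟩) =
        y (pathPos J πc x i ⟨0, by have := hm i; have := hn i; omega⟩) := by
  have h : restr J x = restr J y ↔ ∀ i v, x ⟨i, J i v⟩ = y ⟨i, J i v⟩ := by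
    simp only [funext_iff, restr, Fin.val_inj]
  rw [Matched, ← h]
  refine and_congr_right fun h => forall_congr' fun i => ?_
  rw [← h]
  rfl

theorem Matched.update {hm : ∀ i, 2 ≤ m i} {hn : ∀ i, n i ≤ m i - 1} {x y : Dig p m}
    (h : Matched hm hn J πc x y) {l : Pos m} (hl : ∀ i v, (⟨i, J i v⟩ : Pos m) ≠ l)
    (s : Fin (p l.1)) :
    Matched hm hn J πc (Function.update x l s) (Function.update y l s) := by
  rw [matched_iff] at h ⊢
  rw [restr_update x hl, restr_update y hl]
  refine ⟨h.1, fun i => ?_⟩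
  rw [pathPos_congr (restr_update x hl s)]
  exact update_apply_eq_of_eq l s (h.2 i)

/-- The edge `j` of the path of block `i` is the first one at whose end `x` and `y` differ. -/
def IsFork (J : (i : Fin k) → Fin (n i) → Fin (m i))
    (πc : ((i : Fin k) → Fin (n i) → ℕ) → (i : Fin k) → Fin (m i - n i) → Fin (m i))
    (x y : Dig p m) (e : Σ i : Fin k, Fin (m i - n i - 1)) : Prop :=
  (∀ i (a : Fin (m i - n i)), i < e.1 ∨ i = e.1 ∧ (a : ℕ) ≤ e.2 →
      x (pathPos J πc x i a) = y (pathPos J πc x i a)) ∧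
    ∀ b : Fin (m e.1 - n e.1), (b : ℕ) = e.2 + 1 →
      x (pathPos J πc x e.1 b) ≠ y (pathPos J πc x e.1 b)

theorem IsFork.unique {x y : Dig p m} {e e' : Σ i : Fin k, Fin (m i - n i - 1)}
    (h : IsFork J πc x y e) (h' : IsFork J πc x y e') : e = e' := by
  have key : ∀ e e' : Σ i : Fin k, Fin (m i - n i - 1), IsFork J πc x y e → IsFork J πc x y e' →
      ¬ (e.1 < e'.1 ∨ e.1 = e'.1 ∧ (e.2 : ℕ) < e'.2) := by
    rintro ⟨i, j⟩ ⟨i', j'⟩ h h' hlt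
    have := j.2
    refine h.2 ⟨j + 1, by simp only; omega⟩ rfl (h'.1 i _ ?_)
    exact hlt.imp_right fun hlt => ⟨hlt.1, hlt.2⟩
  have h₁ := key e e' h h'
  have h₂ := key e' e h' h
  obtain ⟨i, j⟩ := e
  obtain ⟨i', j'⟩ := e'
  obtain rfl : i = i' := by
    by_contra hne
    rcases lt_or_gt_of_ne hne with hlt | hlt
    · exact h₁ (Or.inl hlt)
    · exact h₂ (Or.inl hlt)
  simp only [lt_self_iff_false, true_and, false_or, not_lt] at h₁ h₂
  rw [Fin.ext (le_antisymm h₂ h₁)]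

theorem exists_isFork (hn : ∀ i, n i ≤ m i - 1) (hm : ∀ i, 2 ≤ m i)
    (hJ : ∀ i, Function.Injective (J i))
    (hπ : ∀ c i, Function.Injective (πc c i) ∧ ∀ a b, πc c i a ≠ J i b) {x y : Dig p m}
    (h : Matched hm hn J πc x y) (hxy : x ≠ y) : ∃ e, IsFork J πc x y e := by
  rw [matched_iff] at h
  have hdiff : ∃ i, ∃ a : ℕ, ∃ ha : a < m i - n i,
      x (pathPos J πc x i ⟨a, ha⟩) ≠ y (pathPos J πc x i ⟨a, ha⟩) := by
    obtain ⟨⟨i, b⟩, hb⟩ := Function.ne_iff.1 hxy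
    rcases eq_restricted_or_eq_path ((hn i).trans (Nat.sub_le _ _)) (hJ i) (hπ (restr J x) i).1
      (hπ (restr J x) i).2 b with ⟨v, rfl⟩ | ⟨a, rfl⟩
    · exact absurd (Fin.ext (congrFun₂ h.1 i v)) hb
    · exact ⟨i, a, a.2, hb⟩
  obtain ⟨i, hi, himin⟩ := WellFounded.has_min (wellFounded_lt (α := Fin k)) _ hdiff
  have ha := Nat.find_spec hi
  have hamin := fun b => Nat.find_min hi (m := b)
  set a := Nat.find hi
  obtain ⟨ha, hne⟩ := ha
  have ha0 : a ≠ 0 := fun h0 => hne (by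
    rw [show (⟨a, ha⟩ : Fin (m i - n i)) = ⟨0, h0 ▸ ha⟩ from Fin.ext h0]
    exact h.2 i)
  refine ⟨⟨i, ⟨a - 1, by omega⟩⟩, fun i' b hb => ?_, fun b hb => ?_⟩
  · by_contra hcon
    rcases hb with hb | ⟨hb, hba⟩
    · exact himin i' ⟨b, b.2, hcon⟩ hb
    · subst hb
      exact hamin b (by simp only at hba ⊢; omega) ⟨b.2, hcon⟩
  · obtain rfl : b = ⟨a, ha⟩ := Fin.ext (by simp only at hb ⊢; omega)
    exact hne

/-- The initial vertex of an edge. -/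
def forkPos (J : (i : Fin k) → Fin (n i) → Fin (m i))
    (πc : ((i : Fin k) → Fin (n i) → ℕ) → (i : Fin k) → Fin (m i - n i) → Fin (m i))
    (x : Dig p m) (e : Σ i : Fin k, Fin (m i - n i - 1)) : Pos m :=
  pathPos J πc x e.1 (Fin.castLE (Nat.sub_le _ _) e.2)

theorem IsFork.update (hπ : ∀ c i, Function.Injective (πc c i) ∧ ∀ a b, πc c i a ≠ J i b)
    {x y : Dig p m} {e : Σ i : Fin k, Fin (m i - n i - 1)} (h : IsFork J πc x y e)
    (s : Fin (p (forkPos J πc x e).1)) :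
    IsFork J πc (Function.update x (forkPos J πc x e) s)
      (Function.update y (forkPos J πc x e) s) e := by
  have hr := restr_update (l := forkPos J πc x e) x (restricted_ne_pathPos (fun c i => (hπ c i).2) x e.1
    (Fin.castLE (Nat.sub_le _ _) e.2)) s
  refine ⟨fun i a ha => ?_, fun b hb => ?_⟩
  · rw [pathPos_congr (x := Function.update x _ s) hr]
    exact update_apply_eq_of_eq _ s (h.1 i a ha)
  · rw [pathPos_congr (x := Function.update x _ s) hr]
    have hne : pathPos J πc x e.1 b ≠ forkPos J πc x e :=
      pathPos_ne (fun c i => (hπ c i).1) x (Or.inr (by simp [hb]))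
    rw [Function.update_of_ne hne, Function.update_of_ne hne]
    exact h.2 b hb

theorem pathCoord_update_of_ne {x : Dig p m} {l : Pos m} (hl : ∀ i v, (⟨i, J i v⟩ : Pos m) ≠ l)
    (s : Fin (p l.1)) {i : Fin k} {a : Fin (m i - n i)} (h : pathPos J πc x i a ≠ l) :
    pathCoord J πc (Function.update x l s) i a = pathCoord J πc x i a := by
  rw [pathCoord, pathCoord, pathPos_congr (restr_update x hl s), Function.update_of_ne h]

theorem shiftTerm_update (hm : ∀ i, 2 ≤ m i) (hn : ∀ i, n i ≤ m i - 1) (t : ℕ) {x : Dig p m}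
    {l : Pos m} (hl : ∀ i v, (⟨i, J i v⟩ : Pos m) ≠ l)
    (hlast : ∀ i (a : Fin (m i - n i)), (a : ℕ) + 1 = m i - n i → pathPos J πc x i a ≠ l) (s : Fin (p l.1)) :
    shiftTerm p m n hm hn J πc t (Function.update x l s) = shiftTerm p m n hm hn J πc t x := by
  unfold shiftTerm
  refine Finset.sum_congr rfl fun i _ => ?_
  rw [pathCoord_update_of_ne hl s (hlast i _ (by have := hm i; have := hn i; simp only; omega))]
  simp only [Function.update_of_ne (hl _ _)]

theorem phase_sub_update (hk : 1 ≤ k) (hm : ∀ i, 2 ≤ m i) (hn : ∀ i, n i ≤ m i - 1)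
    (hπ : ∀ c i, Function.Injective (πc c i) ∧ ∀ a b, πc c i a ≠ J i b)
    (F F' : (i : Fin k) → Fin (m i - n i - 1) → ZMod (∏ l, p l) → ZMod (∏ l, p l))
    (g : (i : Fin k) → Fin (m i - n i) → ZMod (∏ l, p l) → ZMod (∏ l, p l))
    (fcr hcr : Fin (k - 1) → ZMod (∏ l, p l) → ZMod (∏ l, p l))
    (lam : Fin (k - 1) → ZMod (∏ l, p l)) (t t' : ℕ) {x y : Dig p m}
    (hxy : restr J x = restr J y) {i : Fin k} {j : Fin (m i - n i - 1)}
    (h : IsFork J πc x y ⟨i, j⟩) {b : Fin (m i - n i)} (hb : (b : ℕ) = j + 1)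
    (s : Fin (p (forkPos J πc x ⟨i, j⟩).1)) :
    phase hk p m n hm hn J F F' πc g fcr hcr lam t
        (Function.update x (forkPos J πc x ⟨i, j⟩) s) -
      phase hk p m n hm hn J F F' πc g fcr hcr lam t'
        (Function.update y (forkPos J πc x ⟨i, j⟩) s) =
    phase hk p m n hm hn J F F' πc g fcr hcr lam t x -
      phase hk p m n hm hn J F F' πc g fcr hcr lam t' y +
      (((∏ l, p l) / p i : ℕ) : ZMod (∏ l, p l)) *
        ((F i j ((s : ℕ) : ZMod (∏ l, p l)) - F i j ((x (forkPos J πc x ⟨i, j⟩) : ℕ))) *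
          (F' i j (x (pathPos J πc x i b) : ℕ) - F' i j (y (pathPos J πc x i b) : ℕ))) := by
  revert s
  set P := forkPos J πc x ⟨i, j⟩ with hP
  intro s
  have hPy : P = forkPos J πc y ⟨i, j⟩ := pathPos_congr hxy _ _
  have hl : ∀ i v, (⟨i, J i v⟩ : Pos m) ≠ P :=
    restricted_ne_pathPos (fun c i => (hπ c i).2) x _ _
  have hinj : ∀ c i, Function.Injective (πc c i) := fun c i => (hπ c i).1
  have hX : ∀ i' (a : Fin (m i' - n i')), i' ≠ i ∨ (a : ℕ) ≠ j →
      pathCoord J πc (Function.update x P s) i' a = pathCoord J πc x i' a :=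
    fun i' a ha => pathCoord_update_of_ne hl s (pathPos_ne hinj x ha)
  have hY : ∀ i' (a : Fin (m i' - n i')), i' ≠ i ∨ (a : ℕ) ≠ j →
      pathCoord J πc (Function.update y P s) i' a = pathCoord J πc y i' a :=
    fun i' a ha => pathCoord_update_of_ne hl s (by rw [hPy]; exact pathPos_ne hinj y ha)
  have hlt : ∀ i' (a : Fin (m i' - n i')), i' < i ∨ i' = i ∧ (a : ℕ) ≤ j →
      pathCoord J πc x i' a = pathCoord J πc y i' a ∧
        pathCoord J πc (Function.update x P s) i' a =
          pathCoord J πc (Function.update y P s) i' a := by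
    intro i' a ha
    have hx := h.1 i' a ha
    have hx' := (h.update hπ s).1 i' a ha
    simp only [pathCoord]
    rw [← pathPos_congr hxy, hx, pathPos_congr (y := Function.update x P s)
      (x := Function.update y P s) (by rw [restr_update _ hl, restr_update _ hl, hxy]), hx']
    exact ⟨rfl, rfl⟩
  have hlast : ∀ i' (a : Fin (m i' - n i')), (a : ℕ) + 1 = m i' - n i' → pathPos J πc x i' a ≠ P := by
    intro i' a ha
    refine pathPos_ne hinj x ?_
    rw [or_iff_not_imp_left, not_not]
    rintro rfl
    have := j.2
    simp only [Fin.val_castLE]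
    omega
  have hXj : pathCoord J πc (Function.update x P s) i (Fin.castLE (Nat.sub_le _ _) j) =
      ((s : ℕ) : ZMod (∏ l, p l)) := by
    rw [pathCoord, pathPos_congr (restr_update x hl s)]
    exact congrArg (fun u : Fin (p i) => ((u : ℕ) : ZMod (∏ l, p l))) (Function.update_self P s x)
  have hYj : pathCoord J πc (Function.update y P s) i (Fin.castLE (Nat.sub_le _ _) j) =
      ((s : ℕ) : ZMod (∏ l, p l)) := by
    rw [← (hlt _ _ (Or.inr ⟨rfl, le_rfl⟩)).2, hXj]
  have hYjx : pathCoord J πc y i (Fin.castLE (Nat.sub_le _ _) j) =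
      ((x P : ℕ) : ZMod (∏ l, p l)) := by
    rw [← (hlt _ _ (Or.inr ⟨rfl, le_rfl⟩)).1]
    rfl
  have hYb : pathCoord J πc y i b = ((y (pathPos J πc x i b) : ℕ) : ZMod (∏ l, p l)) := by
    rw [pathCoord, pathPos_congr hxy]
  have hcoup := coupling_sub hm hn F F' (pathCoord J πc x) (pathCoord J πc y)
    (pathCoord J πc (Function.update x P s)) (pathCoord J πc (Function.update y P s)) i j
    (by
      intro i' a b e ha hb he
      by_cases hbj : i' = i ∧ (b : ℕ) = j
      · have hai : i' = i ∧ (a : ℕ) ≤ j := ⟨hbj.1, by omega⟩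
        have h₁ := hlt i' a (Or.inr hai)
        have h₂ := hlt i' b (Or.inr ⟨hbj.1, hbj.2.le⟩)
        rw [h₁.1, h₁.2, h₂.1, h₂.2, sub_self, sub_self]
      · rw [not_and_or] at hbj
        have ha' : i' ≠ i ∨ (a : ℕ) ≠ j := ha ▸ he
        rw [hX i' a ha', hY i' a ha', hX i' b hbj, hY i' b hbj])
    (Fin.castLE (Nat.sub_le _ _) j) b rfl hb
  have hbne : i ≠ i ∨ (b : ℕ) ≠ j := Or.inr (by omega)
  rw [hXj, hYj, hYjx, hX i b hbne, hY i b hbne, hYb] at hcoup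
  have hdiag := diagonal_sub g (pathCoord J πc x) (pathCoord J πc y)
    (pathCoord J πc (Function.update x P s)) (pathCoord J πc (Function.update y P s))
    (by
      intro i' a
      by_cases ha : i' = i ∧ (a : ℕ) = j
      · exact Or.inr (hlt i' a (Or.inr ⟨ha.1, ha.2.le⟩))
      · rw [not_and_or] at ha
        exact Or.inl ⟨hX i' a ha, hY i' a ha⟩)
  have hlink := linking_sub hk hm hn fcr hcr lam (pathCoord J πc x) (pathCoord J πc y)
    (pathCoord J πc (Function.update x P s)) (pathCoord J πc (Function.update y P s)) i j
    (fun i' a ha => ⟨hX i' a ha, hY i' a ha⟩) hlt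
  have hsx := shiftTerm_update (πc := πc) hm hn t hl hlast s
  have hsy := shiftTerm_update (πc := πc) hm hn t' (x := y) hl
    (fun i a ha => by rw [← pathPos_congr hxy]; exact hlast i a ha) s
  unfold phase
  rw [hsx, hsy]
  have hPx : pathCoord J πc x i (Fin.castLE (Nat.sub_le _ _) j) =
    ((x P : ℕ) : ZMod (∏ l, p l)) := rfl
  have hQx : pathCoord J πc x i b = ((x (pathPos J πc x i b) : ℕ) : ZMod (∏ l, p l)) := rfl
  rw [hPx, hQx] at hcoup
  linear_combination hcoup + hdiag + hlink

end Fork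

section Sufficiency

variable {k : ℕ} {p m n : Fin k → ℕ} {J : (i : Fin k) → Fin (n i) → Fin (m i)}
  {πc : ((i : Fin k) → Fin (n i) → ℕ) → (i : Fin k) → Fin (m i - n i) → Fin (m i)}

theorem sum_phase_eq_zero_of_ne_zero [NeZero (∏ l, p l)] (hk : 1 ≤ k) (hp : ∀ i, (p i).Prime)
    (hm : ∀ i, 2 ≤ m i) (hn : ∀ i, n i ≤ m i - 1) (hJ : ∀ i, Function.Injective (J i))
    (hπ : ∀ c i, Function.Injective (πc c i) ∧ ∀ a b, πc c i a ≠ J i b)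
    {F F' : (i : Fin k) → Fin (m i - n i - 1) → ZMod (∏ l, p l) → ZMod (∏ l, p l)}
    (hF : ∀ i j, PermutesMod (∏ l, p l) (p i) (F i j) ∧ PermutesMod (∏ l, p l) (p i) (F' i j))
    (g : (i : Fin k) → Fin (m i - n i) → ZMod (∏ l, p l) → ZMod (∏ l, p l))
    (fcr hcr : Fin (k - 1) → ZMod (∏ l, p l) → ZMod (∏ l, p l))
    (lam : Fin (k - 1) → ZMod (∏ l, p l)) (t t' : ℕ) {τ : ℤ} (hτ : τ ≠ 0) :
    ∑ a : Dig p m × Dig p m with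
      (digVal p m a.2 : ℤ) - digVal p m a.1 = τ ∧ Matched hm hn J πc a.1 a.2,
      ZMod.stdAddChar (phase hk p m n hm hn J F F' πc g fcr hcr lam t a.1 -
        phase hk p m n hm hn J F F' πc g fcr hcr lam t' a.2) = 0 := by
  have hne : ∀ a : Dig p m × Dig p m, (digVal p m a.2 : ℤ) - digVal p m a.1 = τ → a.1 ≠ a.2 := by
    intro a ha h
    exact hτ (by rw [← ha, h, sub_self])
  have hex : ∀ a : Dig p m × Dig p m, ∃ l : Pos m,
      (digVal p m a.2 : ℤ) - digVal p m a.1 = τ ∧ Matched hm hn J πc a.1 a.2 →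
        ∃ e, IsFork J πc a.1 a.2 e ∧ l = forkPos J πc a.1 e := by
    intro a
    by_cases h : (digVal p m a.2 : ℤ) - digVal p m a.1 = τ ∧ Matched hm hn J πc a.1 a.2
    · obtain ⟨e, he⟩ := exists_isFork hn hm hJ hπ h.2 (hne a h.1)
      exact ⟨_, fun _ => ⟨e, he, rfl⟩⟩
    · exact ⟨⟨⟨0, hk⟩, ⟨0, two_pos.trans_le (hm _)⟩⟩, fun h' => absurd h' h⟩
  choose P hP using hex
  have hl : ∀ (x : Dig p m) e i v, (⟨i, J i v⟩ : Pos m) ≠ forkPos J πc x e :=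
    fun x e => restricted_ne_pathPos (fun c i => (hπ c i).2) x _ _
  have hmem : ∀ a : Dig p m × Dig p m, (digVal p m a.2 : ℤ) - digVal p m a.1 = τ ∧
      Matched hm hn J πc a.1 a.2 → ∀ s,
      (digVal p m (Function.update a.2 (P a) s) : ℤ) - digVal p m (Function.update a.1 (P a) s) = τ ∧
        Matched hm hn J πc (Function.update a.1 (P a) s) (Function.update a.2 (P a) s) := by
    intro a ha
    obtain ⟨e, he, hPe⟩ := hP a ha
    rw [hPe]
    intro s
    exact ⟨(sub_digVal_update _ _ _ (he.1 _ _ (Or.inr ⟨rfl, le_rfl⟩)) s).trans ha.1,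
      ha.2.update (hl _ _) s⟩
  refine sum_pairs_eq_zero hp _ P _ ?_ ?_ ?_ ?_
  all_goals
    intro a ha
    rw [Finset.mem_filter_univ] at ha
    obtain ⟨e, he, hPe⟩ := hP a ha
    have hmem' := hmem a ha
  · rw [hPe]
    exact he.1 _ _ (Or.inr ⟨rfl, le_rfl⟩)
  · intro s
    rw [Finset.mem_filter_univ]
    exact hmem' s
  · intro s
    obtain ⟨e', he', hPe'⟩ := hP (Function.update a.1 (P a) s, Function.update a.2 (P a) s)
      (hmem' s)
    rw [hPe']
    revert s
    rw [hPe]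
    intro s he' _
    have hs := he.update hπ s
    obtain rfl : e' = e := IsFork.unique (x := Function.update a.1 _ s)
      (y := Function.update a.2 _ s) he' hs
    exact pathPos_congr (restr_update _ (hl _ _) s) _ _
  · rw [hPe]
    obtain ⟨i, j⟩ := e
    have hxy := ((matched_iff hm hn _ _).1 ha.2).1
    have hb : (j : ℕ) + 1 < m i - n i := by
      have := j.2
      omega
    have : NeZero (p i) := ⟨(hp i).ne_zero⟩
    have hd : p i ∣ ∏ l, p l := Finset.dvd_prod_of_mem p (Finset.mem_univ i)
    simp only [phase_sub_update hk hm hn hπ F F' g fcr hcr lam t t' hxy he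
      (b := ⟨j + 1, hb⟩) rfl]
    refine sum_stdAddChar_affine hd (hF i j).1 ?_ _ _
    rw [map_sub, sub_ne_zero]
    exact fun h => he.2 ⟨j + 1, hb⟩ rfl
      (((permutesMod_iff hd _).1 (hF i j).2).1 h)

theorem exists_digit_ne (hp : ∀ i, (p i).Prime) {t t' : Fin (∏ i, p i ^ m i)} (h : t ≠ t') :
    ∃ i, ∃ v : Fin (m i), bdig p m i t v ≠ bdig p m i t' v := by
  obtain ⟨l, hl⟩ := Function.ne_iff.1 ((toDig_bijective hp m).1.ne h)
  exact ⟨l.1, l.2, fun h => hl (Fin.ext h)⟩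

theorem filter_digVal_sub_eq_zero (hp : ∀ i, (p i).Prime) (hm : ∀ i, 2 ≤ m i)
    (hn : ∀ i, n i ≤ m i - 1) :
    ({a : Dig p m × Dig p m | (digVal p m a.2 : ℤ) - digVal p m a.1 = 0 ∧
      Matched hm hn J πc a.1 a.2} : Finset (Dig p m × Dig p m)) =
      ({a | a.1 = a.2} : Finset (Dig p m × Dig p m)) := by
  ext ⟨x, y⟩
  simp only [Finset.mem_filter_univ, sub_eq_zero, Nat.cast_inj, (digVal_injective hp m).eq_iff]
  refine ⟨fun h => h.1.symm, ?_⟩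
  rintro rfl
  exact ⟨rfl, fun _ _ => rfl, fun _ => rfl⟩

theorem phase_sub_phase (hk : 1 ≤ k) (hm : ∀ i, 2 ≤ m i) (hn : ∀ i, n i ≤ m i - 1)
    (F F' : (i : Fin k) → Fin (m i - n i - 1) → ZMod (∏ l, p l) → ZMod (∏ l, p l))
    (g : (i : Fin k) → Fin (m i - n i) → ZMod (∏ l, p l) → ZMod (∏ l, p l))
    (fcr hcr : Fin (k - 1) → ZMod (∏ l, p l) → ZMod (∏ l, p l))
    (lam : Fin (k - 1) → ZMod (∏ l, p l)) (t t' : ℕ) (x : Dig p m) :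
    phase hk p m n hm hn J F F' πc g fcr hcr lam t x -
      phase hk p m n hm hn J F F' πc g fcr hcr lam t' x =
    ∑ i : Fin k, (((∏ l, p l) / p i : ℕ) : ZMod (∏ l, p l)) *
      ((∑ v : Fin (n i), (((bdig p (fun i => n i + 1) i t v : ℕ) : ZMod (∏ l, p l)) -
          ((bdig p (fun i => n i + 1) i t' v : ℕ) : ZMod (∏ l, p l))) *
          ((x ⟨i, J i v⟩ : ℕ) : ZMod (∏ l, p l))) +
        (((bdig p (fun i => n i + 1) i t (n i) : ℕ) : ZMod (∏ l, p l)) -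
          ((bdig p (fun i => n i + 1) i t' (n i) : ℕ) : ZMod (∏ l, p l))) *
          pathCoord J πc x i ⟨m i - n i - 1, by have := hm i; have := hn i; omega⟩) := by
  rw [phase, phase, add_sub_add_left_eq_sub, shiftTerm, shiftTerm, ← Finset.sum_sub_distrib]
  refine Finset.sum_congr rfl fun i _ => ?_
  simp only [sub_mul, Finset.sum_sub_distrib]
  ring

theorem sum_phase_eq_zero_of_digit_ne [NeZero (∏ l, p l)] (hk : 1 ≤ k) (hp : ∀ i, (p i).Prime)
    (hm : ∀ i, 2 ≤ m i) (hn : ∀ i, n i ≤ m i - 1) (hJ : ∀ i, Function.Injective (J i))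
    (hπ : ∀ c i, Function.Injective (πc c i) ∧ ∀ a b, πc c i a ≠ J i b)
    (F F' : (i : Fin k) → Fin (m i - n i - 1) → ZMod (∏ l, p l) → ZMod (∏ l, p l))
    (g : (i : Fin k) → Fin (m i - n i) → ZMod (∏ l, p l) → ZMod (∏ l, p l))
    (fcr hcr : Fin (k - 1) → ZMod (∏ l, p l) → ZMod (∏ l, p l))
    (lam : Fin (k - 1) → ZMod (∏ l, p l)) {t t' : Fin (∏ i, p i ^ (n i + 1))} (htt : t ≠ t') :
    ∑ a : Dig p m × Dig p m with a.1 = a.2,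
      ZMod.stdAddChar (phase hk p m n hm hn J F F' πc g fcr hcr lam t a.1 -
        phase hk p m n hm hn J F F' πc g fcr hcr lam t' a.2) = 0 := by
  have key : ∀ (P : Dig p m → Pos m), (∀ x s, P (Function.update x (P x) s) = P x) →
      (∀ x, ∃ δ : ZMod (∏ l, p l), ZMod.castHom (Finset.dvd_prod_of_mem p (Finset.mem_univ (P x).1))
        (ZMod (p (P x).1)) δ ≠ 0 ∧ ∀ s : Fin (p (P x).1),
        phase hk p m n hm hn J F F' πc g fcr hcr lam t (Function.update x (P x) s) -
          phase hk p m n hm hn J F F' πc g fcr hcr lam t' (Function.update x (P x) s) =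
        phase hk p m n hm hn J F F' πc g fcr hcr lam t x -
          phase hk p m n hm hn J F F' πc g fcr hcr lam t' x +
          (((∏ l, p l) / p (P x).1 : ℕ) : ZMod (∏ l, p l)) *
            ((id ((s : ℕ) : ZMod (∏ l, p l)) - ((x (P x) : ℕ) : ZMod (∏ l, p l))) * δ)) →
      ∑ a : Dig p m × Dig p m with a.1 = a.2,
        (ZMod.stdAddChar (phase hk p m n hm hn J F F' πc g fcr hcr lam t a.1 -
          phase hk p m n hm hn J F F' πc g fcr hcr lam t' a.2) : ℂ) = 0 := by
    intro P hP hδ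
    refine sum_pairs_eq_zero hp _ (fun a => P a.1) _ ?_ ?_ (fun a _ s => hP a.1 s) ?_
    all_goals
      rintro ⟨x, y⟩ ha
      obtain rfl : x = y := by simpa using ha
    · rfl
    · simp
    · obtain ⟨δ, hδ, h⟩ := hδ x
      have : NeZero (p (P x).1) := ⟨(hp _).ne_zero⟩
      simp only [h]
      exact sum_stdAddChar_affine _ (permutesMod_id
        (Finset.dvd_prod_of_mem p (Finset.mem_univ (P x).1))) hδ _ _
  have hcast : ∀ i (v : Fin (n i + 1)),
      bdig p (fun i => n i + 1) i t v ≠ bdig p (fun i => n i + 1) i t' v →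
      ZMod.castHom (Finset.dvd_prod_of_mem p (Finset.mem_univ i)) (ZMod (p i))
        (((bdig p (fun i => n i + 1) i t v : ℕ) : ZMod (∏ l, p l)) -
          ((bdig p (fun i => n i + 1) i t' v : ℕ) : ZMod (∏ l, p l))) ≠ 0 := fun i v h h' =>
    h (congrArg Fin.val ((castHom_natCast_sub_eq_zero _
      (⟨_, Nat.mod_lt _ (hp i).pos⟩ : Fin (p i)) ⟨_, Nat.mod_lt _ (hp i).pos⟩).1 h'))
  have hinj : ∀ c i, Function.Injective (πc c i) := fun c i => (hπ c i).1
  have hJπ : ∀ c i, ∀ a b, πc c i a ≠ J i b := fun c i => (hπ c i).2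
  by_cases hlast : ∃ i, bdig p (fun i => n i + 1) i t (n i) ≠ bdig p (fun i => n i + 1) i t' (n i)
  · obtain ⟨i, hi⟩ := hlast
    have hlt : m i - n i - 1 < m i - n i := by
      have := hm i
      have := hn i
      omega
    have hl : ∀ (x : Dig p m) i' v, (⟨i', J i' v⟩ : Pos m) ≠ pathPos J πc x i ⟨_, hlt⟩ :=
      fun x => restricted_ne_pathPos hJπ x _ _
    refine key (fun x => pathPos J πc x i ⟨_, hlt⟩) (fun x s => pathPos_congr
      (restr_update x (hl x) s) _ _) fun x => ⟨_, hcast i (Fin.last _) hi, fun s => ?_⟩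
    rw [← sub_eq_iff_eq_add', phase_sub_phase, phase_sub_phase, ← Finset.sum_sub_distrib,
      Finset.sum_eq_single i]
    · have h : pathCoord J πc (Function.update x (pathPos J πc x i ⟨_, hlt⟩) s) i ⟨_, hlt⟩ =
          ((s : ℕ) : ZMod (∏ l, p l)) := by
        rw [pathCoord, pathPos_congr (restr_update x (hl x) s)]
        exact congrArg (fun u : Fin (p i) => ((u : ℕ) : ZMod (∏ l, p l)))
          (Function.update_self (pathPos J πc x i ⟨_, hlt⟩) s x)
      rw [h]
      simp only [Function.update_of_ne (hl x _ _), pathCoord, id, Fin.val_last]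
      simp only [pathPos]
      ring
    · intro i' _ hi'
      rw [pathCoord_update_of_ne (hl x) s (pathPos_ne hinj x (Or.inl hi'))]
      simp only [Function.update_of_ne (hl x _ _), sub_self]
    · simp
  · push Not at hlast
    obtain ⟨i, v, hv⟩ := exists_digit_ne (m := fun i => n i + 1) hp htt
    have hvn : (v : ℕ) < n i := lt_of_le_of_ne (Nat.lt_succ_iff.1 v.2) fun h =>
      hv (by rw [h]; exact hlast i)
    refine key (fun x => ⟨i, J i ⟨v, hvn⟩⟩) (fun x s => rfl) fun x =>
      ⟨_, hcast i v hv, fun s => ?_⟩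
    rw [← sub_eq_iff_eq_add', phase_sub_phase, phase_sub_phase, ← Finset.sum_sub_distrib,
      Finset.sum_eq_single i]
    · rw [← mul_sub, hlast, sub_self, zero_mul, zero_mul, add_zero, add_zero,
        ← Finset.sum_sub_distrib, Finset.sum_eq_single ⟨v, hvn⟩]
      · simp only [Function.update_self, id]
        ring
      · intro v' _ hv'
        rw [Function.update_of_ne, sub_self]
        intro h
        exact hv' (hJ i (eq_of_heq (Sigma.mk.inj_iff.1 h).2))
      · simp
    · intro i' _ hi'
      rw [hlast, sub_self, zero_mul, zero_mul, add_zero, add_zero, ← mul_sub,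
        ← Finset.sum_sub_distrib, Finset.sum_eq_zero, mul_zero]
      intro v' _
      rw [Function.update_of_ne, sub_self]
      exact fun h => hi' (Sigma.mk.inj_iff.1 h).1
    · simp

theorem isCCC_psiK [NeZero (∏ l, p l)] (hk : 1 ≤ k) (hp : ∀ i, (p i).Prime)
    (hm : ∀ i, 2 ≤ m i) (hn : ∀ i, n i ≤ m i - 1) (hJ : ∀ i, Function.Injective (J i))
    (hπ : ∀ c i, Function.Injective (πc c i) ∧ ∀ a b, πc c i a ≠ J i b)
    {F F' : (i : Fin k) → Fin (m i - n i - 1) → ZMod (∏ l, p l) → ZMod (∏ l, p l)}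
    (hF : ∀ i j, PermutesMod (∏ l, p l) (p i) (F i j) ∧ PermutesMod (∏ l, p l) (p i) (F' i j))
    (g : (i : Fin k) → Fin (m i - n i) → ZMod (∏ l, p l) → ZMod (∏ l, p l))
    (fcr hcr : Fin (k - 1) → ZMod (∏ l, p l) → ZMod (∏ l, p l))
    (lam : Fin (k - 1) → ZMod (∏ l, p l)) :
    IsCCC (∏ i, p i ^ m i) (fun t : Fin (∏ i, p i ^ (n i + 1)) =>
      psiK k hk p m n hm hn J F F' πc g fcr hcr lam t.val) := by
  refine ⟨by simp [pow_succ], fun t t' τ _ => ?_⟩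
  rw [codeACCF_psiK hk hp]
  by_cases hτ : τ = 0
  · subst hτ
    rw [filter_digVal_sub_eq_zero hp]
    by_cases htt : t = t'
    · subst htt
      rw [Finset.sum_congr rfl (g := fun _ => (1 : ℂ))]
      · have hcard := Fintype.card_of_bijective (toDig_bijective hp m)
        rw [Finset.sum_filter, Fintype.sum_prod_type]
        simp only [Finset.sum_ite_eq, Finset.mem_univ, if_true, Finset.sum_const, Finset.card_univ,
          ← hcard, Fintype.card_fin, nsmul_eq_mul, mul_one, and_self]
      · intro a ha
        rw [Finset.mem_filter_univ] at ha
        rw [ha, sub_self, AddChar.map_zero_eq_one]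
    · rw [sum_phase_eq_zero_of_digit_ne hk hp hm hn hJ hπ F F' g fcr hcr lam htt]
      simp [htt]
  · rw [sum_phase_eq_zero_of_ne_zero hk hp hm hn hJ hπ hF g fcr hcr lam t t' hτ]
    simp [hτ]

end Sufficiency

section Necessity

theorem sum_filter_eq_zero_of_forall {q : ℕ} [NeZero q] {G : Type*} [AddCommGroup G] [Finite G]
    {ι : Type*} (S : Finset ι) (w : ι → ℂ) (ℓ : ι → G →+ ZMod q)
    (H : ∀ g, ∑ s ∈ S, w s * ZMod.stdAddChar (ℓ s g) = 0) : ∑ s ∈ S with ℓ s = 0, w s = 0 := by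
  have := Fintype.ofFinite G
  have hℓ : ∀ f : G →+ ZMod q,
      ∑ g, (ZMod.stdAddChar (f g) : ℂ) = if f = 0 then (Fintype.card G : ℂ) else 0 := by
    intro f
    have h := AddChar.sum_eq_ite (ZMod.stdAddChar.compAddMonoidHom f : AddChar G ℂ)
    simp only [AddChar.compAddMonoidHom_apply] at h
    rw [h]
    refine if_congr ?_ rfl rfl
    rw [AddChar.ext_iff, DFunLike.ext_iff]
    refine forall_congr' fun g => ?_
    rw [AddChar.compAddMonoidHom_apply, AddChar.zero_apply,
      ← AddChar.map_zero_eq_one (ZMod.stdAddChar (N := q)), ZMod.injective_stdAddChar.eq_iff]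
    rfl
  have h : ∑ g, ∑ s ∈ S, w s * ZMod.stdAddChar (ℓ s g) = 0 := Finset.sum_eq_zero fun g _ => H g
  rw [Finset.sum_comm] at h
  simp only [← Finset.mul_sum, hℓ, mul_ite, mul_zero] at h
  rw [← Finset.sum_filter, ← Finset.sum_mul] at h
  convert (mul_eq_zero.1 h).resolve_right (Nat.cast_ne_zero.2 Fintype.card_ne_zero)

variable {k : ℕ} {p m n : Fin k → ℕ}

theorem sum_eq_zero_of_sum_apply_eq_zero {P : Pos m} {S : Finset (Dig p m)} (hS : S.Nonempty)
    (hmem : ∀ x ∈ S, ∀ s, Function.update x P s ∈ S) {h : Fin (p P.1) → ℂ}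
    (hsum : ∑ x ∈ S, h (x P) = 0) : ∑ s, h s = 0 := by
  have key : ∑ b ∈ S ×ˢ (Finset.univ : Finset (Fin (p P.1))), h (b.1 P) =
      ∑ b ∈ S ×ˢ (Finset.univ : Finset (Fin (p P.1))), h b.2 := by
    refine Finset.sum_nbij' (fun b => (Function.update b.1 P b.2, b.1 P))
      (fun b => (Function.update b.1 P b.2, b.1 P)) ?_ ?_ ?_ ?_ ?_
    all_goals
      rintro ⟨x, s⟩ hb
      have hx : x ∈ S := (Finset.mem_product.1 hb).1
    · simpa using hmem x hx s
    · simpa using hmem x hx s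
    · simp
    · simp
    · rfl
  rw [Finset.sum_product_right, Finset.sum_product] at key
  simp only [hsum, Finset.sum_const, smul_zero] at key
  exact (smul_eq_zero.1 key.symm).resolve_left hS.card_ne_zero

theorem eq_and_eq_of_digVal_sub (hp : ∀ i, (p i).Prime) {x y a b : Dig p m}
    (h : (digVal p m y : ℤ) - digVal p m x = digVal p m b - digVal p m a)
    (heq : ∀ l, a l = b l → x l = y l)
    (hne : ∀ l, a l ≠ b l → (x l = a l ∧ y l = b l) ∨ (x l = b l ∧ y l = a l)) (l : Pos m)
    (hl : a l ≠ b l) : x l = a l ∧ y l = b l := by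
  let z : Dig p m := fun l => if a l = b l then a l else x l
  have hz : z = a := by
    refine digVal_injective hp m ?_
    have hsum : (digVal p m y : ℤ) - digVal p m x =
        digVal p m b - digVal p m a - 2 * (digVal p m z - digVal p m a) := by
      simp only [digVal, Nat.cast_sum, ← Finset.sum_sub_distrib, Finset.mul_sum]
      refine Finset.sum_congr rfl fun l _ => ?_
      simp only [z]
      by_cases hab : a l = b l
      · simp [hab, heq l hab]
      · rw [if_neg hab]
        rcases hne l hab with ⟨h₁, h₂⟩ | ⟨h₁, h₂⟩ <;> rw [h₁, h₂] <;> push_cast <;> ring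
    omega
  have hxl : x l = a l := by
    have := congrFun hz l
    simpa only [z, if_neg hl] using this
  refine ⟨hxl, ?_⟩
  rcases hne l hl with h | h
  · exact h.2
  · exact absurd (hxl.symm.trans h.1) hl

theorem eq_or_swap_of_diagonal (hq : 1 < ∏ l, p l)
    {X Y A B : (i : Fin k) → Fin (m i - n i) → ZMod (∏ l, p l)}
    (h : ∀ g, diagonal p m n g X - diagonal p m n g Y -
      (diagonal p m n g A - diagonal p m n g B) = 0) (i : Fin k) (j : Fin (m i - n i)) :
    (A i j = B i j → X i j = Y i j) ∧
      (A i j ≠ B i j → (X i j = A i j ∧ Y i j = B i j) ∨ (X i j = B i j ∧ Y i j = A i j)) := by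
  have : Fact (1 < ∏ l, p l) := ⟨hq⟩
  have hd : ∀ u (Z : (i : Fin k) → Fin (m i - n i) → ZMod (∏ l, p l)),
      diagonal p m n (fun i' j' z =>
        if (⟨i', j'⟩ : Σ i, Fin (m i - n i)) = ⟨i, j⟩ ∧ z = u then 1 else 0) Z =
      if Z i j = u then 1 else 0 := by
    intro u Z
    rw [diagonal, ← Fintype.sum_sigma' (fun i' (j' : Fin (m i' - n i')) =>
      if (⟨i', j'⟩ : Σ i, Fin (m i - n i)) = ⟨i, j⟩ ∧ Z i' j' = u then (1 : ZMod (∏ l, p l)) else 0),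
      Finset.sum_eq_single ⟨i, j⟩]
    · simp
    · rintro b - hb
      simp [hb]
    · simp
  have hu : ∀ u, (if X i j = u then (1 : ZMod (∏ l, p l)) else 0) - (if Y i j = u then 1 else 0) -
      ((if A i j = u then 1 else 0) - (if B i j = u then 1 else 0)) = 0 := by
    intro u
    rw [← hd u X, ← hd u Y, ← hd u A, ← hd u B]
    exact h _
  constructor
  · intro hAB
    have := hu (X i j)
    rw [hAB, sub_self, sub_zero, if_pos rfl] at this
    by_contra hne
    simp [Ne.symm hne] at this
  · intro hAB
    have hA := hu (A i j)
    have hB := hu (B i j)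
    simp only [if_true, hAB, Ne.symm hAB, if_false] at hA hB
    by_cases h₁ : X i j = A i j
    · left
      refine ⟨h₁, ?_⟩
      by_contra h₂
      simp [h₁, hAB, h₂] at hB
    · right
      by_cases h₂ : Y i j = A i j
      · refine ⟨?_, h₂⟩
        by_contra h₃
        simp [h₂, hAB, h₃] at hB
      · simp [h₁, h₂] at hA

end Necessity

section Necessity

variable {k : ℕ} {p m n : Fin k → ℕ} {J : (i : Fin k) → Fin (n i) → Fin (m i)}

theorem exists_complementary_path {r s : ℕ} {J : Fin r → Fin s} (hJ : Function.Injective J) :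
    ∃ π : Fin (s - r) → Fin s, Function.Injective π ∧ ∀ a b, π a ≠ J b := by
  have hcard : (Finset.univ.image J)ᶜ.card = s - r := by
    rw [Finset.card_compl, Finset.card_image_of_injective _ hJ]
    simp
  refine ⟨(Finset.univ.image J)ᶜ.orderEmbOfFin hcard, RelEmbedding.injective _, fun a b h => ?_⟩
  have := (Finset.univ.image J)ᶜ.orderEmbOfFin_mem hcard a
  rw [h] at this
  simp at this

theorem phase_zero (hk : 1 ≤ k) (hm : ∀ i, 2 ≤ m i) (hn : ∀ i, n i ≤ m i - 1)
    (F F' : (i : Fin k) → Fin (m i - n i - 1) → ZMod (∏ l, p l) → ZMod (∏ l, p l))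
    (πc : ((i : Fin k) → Fin (n i) → ℕ) → (i : Fin k) → Fin (m i - n i) → Fin (m i))
    (g : (i : Fin k) → Fin (m i - n i) → ZMod (∏ l, p l) → ZMod (∏ l, p l)) (x : Dig p m) :
    phase hk p m n hm hn J F F' πc g 0 0 0 0 x =
      coupling p m n hm hn F F' (pathCoord J πc x) + diagonal p m n g (pathCoord J πc x) := by
  simp [phase, linking, shiftTerm, bdig]

theorem sum_coupling_eq_zero [NeZero (∏ l, p l)] (hk : 1 ≤ k) (hp : ∀ i, (p i).Prime)
    (hm : ∀ i, 2 ≤ m i) (hn : ∀ i, n i ≤ m i - 1)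
    {F F' : (i : Fin k) → Fin (m i - n i - 1) → ZMod (∏ l, p l) → ZMod (∏ l, p l)}
    {πc : ((i : Fin k) → Fin (n i) → ℕ) → (i : Fin k) → Fin (m i - n i) → Fin (m i)}
    (H : ∀ g, IsCCC (∏ i, p i ^ m i) (fun t : Fin (∏ i, p i ^ (n i + 1)) =>
      psiK k hk p m n hm hn J F F' πc g 0 0 0 t.val))
    {a b : Dig p m} (hab : a ≠ b) :
    ∑ z : Dig p m × Dig p m with
      ((digVal p m z.2 : ℤ) - digVal p m z.1 = digVal p m b - digVal p m a ∧
        Matched hm hn J πc z.1 z.2) ∧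
      ∀ g, diagonal p m n g (pathCoord J πc z.1) - diagonal p m n g (pathCoord J πc z.2) -
        (diagonal p m n g (pathCoord J πc a) - diagonal p m n g (pathCoord J πc b)) = 0,
      ZMod.stdAddChar (coupling p m n hm hn F F' (pathCoord J πc z.1) -
        coupling p m n hm hn F F' (pathCoord J πc z.2)) = 0 := by
  have hK : 0 < ∏ i, p i ^ (n i + 1) := Finset.prod_pos fun i _ => pow_pos (hp i).pos _
  have h0 : (digVal p m b : ℤ) - digVal p m a ≠ 0 := fun h =>
    hab (digVal_injective hp m (by omega))
  let ℓ : Dig p m × Dig p m →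
      ((i : Fin k) → Fin (m i - n i) → ZMod (∏ l, p l) → ZMod (∏ l, p l)) →+ ZMod (∏ l, p l) :=
    fun z => AddMonoidHom.mk' (fun g =>
      diagonal p m n g (pathCoord J πc z.1) - diagonal p m n g (pathCoord J πc z.2) -
        (diagonal p m n g (pathCoord J πc a) - diagonal p m n g (pathCoord J πc b))) fun g g' => by
      simp only [diagonal, Pi.add_apply, Finset.sum_add_distrib]
      ring
  have h := sum_filter_eq_zero_of_forall
    ({z : Dig p m × Dig p m | (digVal p m z.2 : ℤ) - digVal p m z.1 =
      digVal p m b - digVal p m a ∧ Matched hm hn J πc z.1 z.2} : Finset (Dig p m × Dig p m))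
    (fun z => ZMod.stdAddChar (coupling p m n hm hn F F' (pathCoord J πc z.1) -
        coupling p m n hm hn F F' (pathCoord J πc z.2))) ℓ ?_
  · rw [Finset.filter_filter] at h
    simpa only [ℓ, DFunLike.ext_iff, AddMonoidHom.mk'_apply, AddMonoidHom.zero_apply] using h
  · intro g
    have hg := (H g).2 ⟨0, hK⟩ ⟨0, hK⟩ (digVal p m b - digVal p m a) (by
      have ha := digVal_lt hp m a
      have hb := digVal_lt hp m b
      rw [abs_lt]
      omega)
    rw [if_neg (fun h => h0 h.1), codeACCF_psiK hk hp] at hg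
    have hg' := (mul_eq_zero.1 hg).resolve_left (Nat.cast_ne_zero.2 hK.ne')
    rw [← mul_zero (ZMod.stdAddChar (-(diagonal p m n g (pathCoord J πc a) -
      diagonal p m n g (pathCoord J πc b))) : ℂ), ← hg', Finset.mul_sum]
    refine Finset.sum_congr rfl fun z _ => ?_
    rw [← AddChar.map_add_eq_mul, ← AddChar.map_add_eq_mul, phase_zero, phase_zero]
    congr 1
    simp only [ℓ, AddMonoidHom.mk'_apply]
    ring

theorem sum_stdAddChar_eq_zero_of_isCCC [NeZero (∏ l, p l)] (hk : 1 ≤ k) (hp : ∀ i, (p i).Prime)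
    (hm : ∀ i, 2 ≤ m i) (hn : ∀ i, n i ≤ m i - 1) (hJ : ∀ i, Function.Injective (J i))
    {F F' : (i : Fin k) → Fin (m i - n i - 1) → ZMod (∏ l, p l) → ZMod (∏ l, p l)}
    {π : (i : Fin k) → Fin (m i - n i) → Fin (m i)}
    (hπ : ∀ i, Function.Injective (π i) ∧ ∀ a b, π i a ≠ J i b)
    (H : ∀ g, IsCCC (∏ i, p i ^ m i) (fun t : Fin (∏ i, p i ^ (n i + 1)) =>
      psiK k hk p m n hm hn J F F' (fun _ => π) g 0 0 0 t.val))
    (i : Fin k) (j : Fin (m i - n i - 1)) {α β : Fin (p i)} (hαβ : α ≠ β) :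
    ∑ u : Fin (p i), ZMod.stdAddChar ((((∏ l, p l) / p i : ℕ) : ZMod (∏ l, p l)) *
      (F i j ((u : ℕ) : ZMod (∏ l, p l)) *
        (F' i j ((α : ℕ) : ZMod (∏ l, p l)) - F' i j ((β : ℕ) : ZMod (∏ l, p l))))) = 0 := by
  have hpi : p i ∣ ∏ l, p l := Finset.dvd_prod_of_mem p (Finset.mem_univ i)
  have hq : 1 < ∏ l, p l :=
    (hp i).one_lt.trans_le (Nat.le_of_dvd (Nat.pos_of_ne_zero (NeZero.ne _)) hpi)
  have hjlt : (j : ℕ) + 1 < m i - n i := by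
    have := j.2
    omega
  set πc : ((i : Fin k) → Fin (n i) → ℕ) → (i : Fin k) → Fin (m i - n i) → Fin (m i) :=
    fun _ => π
  let Q : Pos m := ⟨i, π i ⟨j + 1, hjlt⟩⟩
  let T : Pos m → Prop := fun l => ∃ c : Fin (m i - n i), (j : ℕ) < c ∧ l = ⟨i, π i c⟩
  have hinj : ∀ {i' i'' : Fin k} {c : Fin (m i' - n i')} {d : Fin (m i'' - n i'')},
      (⟨i', π i' c⟩ : Pos m) = ⟨i'', π i'' d⟩ → i' = i'' ∧ (c : ℕ) = d := by
    intro i' i'' c d h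
    obtain ⟨rfl, h⟩ := Sigma.mk.inj_iff.1 h
    exact ⟨rfl, congrArg Fin.val ((hπ _).1 (eq_of_heq h))⟩
  have hTπ : ∀ {i' : Fin k} {c : Fin (m i' - n i')},
      T ⟨i', π i' c⟩ ↔ i' = i ∧ (j : ℕ) < c := by
    intro i' c
    constructor
    · rintro ⟨d, hd, h⟩
      obtain ⟨h₁, h₂⟩ := hinj h
      exact ⟨h₁, h₂ ▸ hd⟩
    · rintro ⟨rfl, h⟩
      exact ⟨c, h, rfl⟩
  have hTJ : ∀ i' v, ¬ T ⟨i', J i' v⟩ := by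
    rintro i' v ⟨c, -, h⟩
    obtain ⟨rfl, h⟩ := Sigma.mk.inj_iff.1 h
    exact (hπ i').2 _ _ (eq_of_heq h).symm
  let a : Dig p m := Function.update (fun l => ⟨0, (hp l.1).pos⟩) Q α
  let b : Dig p m := Function.update
    (fun l => if T l then ⟨1, (hp l.1).one_lt⟩ else ⟨0, (hp l.1).pos⟩) Q β
  have hTQ : T Q := hTπ.2 ⟨rfl, Nat.lt_succ_self _⟩
  have haQ : a Q = α := Function.update_self ..
  have hbQ : b Q = β := Function.update_self ..
  have hab : ∀ l, a l ≠ b l ↔ T l := by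
    intro l
    by_cases hl : l = Q
    · subst hl
      rw [haQ, hbQ]
      exact iff_of_true hαβ hTQ
    · simp only [a, b, Function.update_of_ne hl]
      split_ifs with h <;> simp [h]
  have hsum := sum_coupling_eq_zero hk hp hm hn H (a := a) (b := b)
    (fun h => (hab Q).2 hTQ (by rw [h]))
  let y : Dig p m → Dig p m := fun x l => if T l then b l else x l
  have hnT : ∀ i', ¬ T ⟨i', π i' ⟨0, by have := hm i'; have := hn i'; omega⟩⟩ := by
    intro i' h
    exact absurd (hTπ.1 h).2 (Nat.not_lt_zero _)
  have hcast : ∀ {i'} (u v : Fin (p i')),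
      ((u : ℕ) : ZMod (∏ l, p l)) = ((v : ℕ) : ZMod (∏ l, p l)) ↔ u = v := by
    intro i' u v
    rw [← castHom_natCast_sub_eq_zero (Finset.dvd_prod_of_mem p (Finset.mem_univ i'))]
    refine ⟨fun h => by rw [h, sub_self, map_zero], fun h => ?_⟩
    rw [(castHom_natCast_sub_eq_zero _ _ _).1 h]
  have hcoord : ∀ (x x' : Dig p m) (i' : Fin k) (c : Fin (m i' - n i')),
      pathCoord J πc x i' c = pathCoord J πc x' i' c ↔
        x ⟨i', π i' c⟩ = x' ⟨i', π i' c⟩ := fun _ _ _ _ => hcast _ _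
  have hset : ∀ z : Dig p m × Dig p m,
      (((digVal p m z.2 : ℤ) - digVal p m z.1 = digVal p m b - digVal p m a ∧
        Matched hm hn J πc z.1 z.2) ∧
      ∀ g, diagonal p m n g (pathCoord J πc z.1) - diagonal p m n g (pathCoord J πc z.2) -
        (diagonal p m n g (pathCoord J πc a) - diagonal p m n g (pathCoord J πc b)) = 0) ↔
      (∀ l, T l → z.1 l = a l) ∧ z.2 = y z.1 := by
    rintro ⟨x, x'⟩
    constructor
    · rintro ⟨⟨hτ, hM⟩, hg⟩
      have hpath := fun i' c => eq_or_swap_of_diagonal hq hg i' c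
      simp only [hcoord, ne_eq] at hpath
      have hall : ∀ l, (a l = b l → x l = x' l) ∧
          (a l ≠ b l → (x l = a l ∧ x' l = b l) ∨ (x l = b l ∧ x' l = a l)) := by
        rintro ⟨i', c⟩
        rcases eq_restricted_or_eq_path ((hn i').trans (Nat.sub_le _ _)) (hJ i') (hπ i').1
          (hπ i').2 c with ⟨v, rfl⟩ | ⟨d, rfl⟩
        · exact ⟨fun _ => hM.1 i' v, fun h => absurd ((hab _).1 h) (hTJ i' v)⟩
        · exact hpath i' d
      have hne := eq_and_eq_of_digVal_sub hp hτ (fun l => (hall l).1) (fun l => (hall l).2)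
      refine ⟨fun l hl => (hne l ((hab l).2 hl)).1, funext fun l => ?_⟩
      simp only [y]
      split_ifs with hl
      · exact (hne l ((hab l).2 hl)).2
      · exact ((hall l).1 (not_not.1 fun h => hl ((hab l).1 h))).symm
    · rintro ⟨hx, rfl : x' = y x⟩
      have hy : ∀ l, (x l = a l ∧ y x l = b l) ∨ (a l = b l ∧ x l = y x l) := by
        intro l
        by_cases hl : T l
        · exact Or.inl ⟨hx l hl, if_pos hl⟩
        · exact Or.inr ⟨not_not.1 fun h => hl ((hab l).1 h), (if_neg hl).symm⟩
      refine ⟨⟨?_, fun i' v => (if_neg (hTJ i' v)).symm, fun i' => (if_neg (hnT i')).symm⟩,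
        fun g => ?_⟩
      · simp only [digVal, Nat.cast_sum, ← Finset.sum_sub_distrib]
        refine Finset.sum_congr rfl fun l _ => ?_
        rcases hy l with ⟨h₁, h₂⟩ | ⟨h₁, h₂⟩ <;> rw [h₁, h₂]
        rw [sub_self, sub_self]
      · rw [sub_eq_zero]
        refine diagonal_sub g _ _ _ _ fun i' c => ?_
        simp only [hcoord]
        exact (hy ⟨i', π i' c⟩).imp_right id
  simp only [hset] at hsum
  let P : Pos m := ⟨i, π i (Fin.castLE (Nat.sub_le _ _) j)⟩
  have hTP : ¬ T P := fun h => lt_irrefl _ (hTπ.1 h).2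
  have hcoup : ∀ x : Dig p m, (∀ l, T l → x l = a l) →
      coupling p m n hm hn F F' (pathCoord J πc x) -
        coupling p m n hm hn F F' (pathCoord J πc (y x)) =
      coupling p m n hm hn F F' (pathCoord J πc a) -
        coupling p m n hm hn F F' (pathCoord J πc b) +
      (((∏ l, p l) / p i : ℕ) : ZMod (∏ l, p l)) *
        ((F i j ((x P : ℕ) : ZMod (∏ l, p l)) - F i j ((a P : ℕ) : ZMod (∏ l, p l))) *
          (F' i j ((α : ℕ) : ZMod (∏ l, p l)) - F' i j ((β : ℕ) : ZMod (∏ l, p l)))) := by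
    intro x hx
    have hT : ∀ i' (c : Fin (m i' - n i')), T ⟨i', π i' c⟩ →
        pathCoord J πc x i' c = pathCoord J πc a i' c ∧
          pathCoord J πc (y x) i' c = pathCoord J πc b i' c := by
      intro i' c hc
      simp only [hcoord]
      exact ⟨hx _ hc, if_pos hc⟩
    have hT' : ∀ i' (c : Fin (m i' - n i')), ¬ T ⟨i', π i' c⟩ →
        pathCoord J πc x i' c = pathCoord J πc (y x) i' c ∧
          pathCoord J πc a i' c = pathCoord J πc b i' c := by
      intro i' c hc
      simp only [hcoord]
      exact ⟨(if_neg hc).symm, not_not.1 fun h => hc ((hab _).1 h)⟩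
    have h := coupling_sub hm hn F F' (pathCoord J πc a) (pathCoord J πc b) (pathCoord J πc x)
      (pathCoord J πc (y x)) i j ?_ (Fin.castLE (Nat.sub_le _ _) j) ⟨j + 1, hjlt⟩ rfl rfl
    · rw [h, (hT i ⟨j + 1, hjlt⟩ hTQ).1, (hT i ⟨j + 1, hjlt⟩ hTQ).2, ← (hT' i _ hTP).1,
        ← (hT' i _ hTP).2]
      have h₁ : pathCoord J πc a i ⟨j + 1, hjlt⟩ = ((α : ℕ) : ZMod (∏ l, p l)) :=
        (hcast (a Q) α).2 haQ
      have h₂ : pathCoord J πc b i ⟨j + 1, hjlt⟩ = ((β : ℕ) : ZMod (∏ l, p l)) :=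
        (hcast (b Q) β).2 hbQ
      rw [h₁, h₂]
      simp only [pathCoord]
      simp only [pathPos, πc, P]
      ring
    · intro i' c d e hc hd he
      by_cases hTd : T ⟨i', π i' d⟩
      · have hTc : T ⟨i', π i' c⟩ := by
          obtain ⟨rfl, hlt⟩ := hTπ.1 hTd
          refine hTπ.2 ⟨rfl, ?_⟩
          have := he.resolve_left (not_not.2 rfl)
          omega
        rw [(hT i' c hTc).1, (hT i' c hTc).2, (hT i' d hTd).1, (hT i' d hTd).2]
      · have hTc : ¬ T ⟨i', π i' c⟩ := fun h => hTd (by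
          obtain ⟨rfl, hlt⟩ := hTπ.1 h
          exact hTπ.2 ⟨rfl, by omega⟩)
        rw [(hT' i' c hTc).1, (hT' i' c hTc).2, (hT' i' d hTd).1, (hT' i' d hTd).2, sub_self,
          sub_self]
  set C := coupling p m n hm hn F F' (pathCoord J πc a) -
    coupling p m n hm hn F F' (pathCoord J πc b)
  let E : Fin (p i) → ZMod (∏ l, p l) := fun u => C + (((∏ l, p l) / p i : ℕ) : ZMod (∏ l, p l)) *
    ((F i j ((u : ℕ) : ZMod (∏ l, p l)) - F i j ((a P : ℕ) : ZMod (∏ l, p l))) *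
      (F' i j ((α : ℕ) : ZMod (∏ l, p l)) - F' i j ((β : ℕ) : ZMod (∏ l, p l))))
  have hE : ∑ u : Fin (p i), (ZMod.stdAddChar (E u) : ℂ) = 0 := by
    refine sum_eq_zero_of_sum_apply_eq_zero (P := P)
      (S := ({x | ∀ l, T l → x l = a l} : Finset (Dig p m)))
      (h := fun u => ZMod.stdAddChar (E u)) ⟨a, by simp⟩ ?_ ?_
    · intro x hx s
      rw [Finset.mem_filter_univ] at hx ⊢
      intro l hl
      rw [Function.update_of_ne (fun h => by rw [h] at hl; exact hTP hl), hx l hl]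
    · rw [← hsum]
      refine Finset.sum_nbij' (fun x => (x, y x)) Prod.fst ?_ ?_ ?_ ?_ ?_
      · intro x hx
        rw [Finset.mem_filter_univ] at hx ⊢
        exact ⟨hx, rfl⟩
      · intro z hz
        rw [Finset.mem_filter_univ] at hz ⊢
        exact hz.1
      · intro x _
        rfl
      · intro z hz
        rw [Finset.mem_filter_univ] at hz
        exact Prod.ext rfl hz.2.symm
      · intro x hx
        rw [Finset.mem_filter_univ] at hx
        exact congrArg _ (hcoup x hx).symm
  rw [← mul_zero (ZMod.stdAddChar (-C + (((∏ l, p l) / p i : ℕ) : ZMod (∏ l, p l)) *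
    (F i j ((a P : ℕ) : ZMod (∏ l, p l)) *
      (F' i j ((α : ℕ) : ZMod (∏ l, p l)) - F' i j ((β : ℕ) : ZMod (∏ l, p l))))) : ℂ), ← hE,
    Finset.mul_sum]
  refine Finset.sum_congr rfl fun u _ => ?_
  rw [← AddChar.map_add_eq_mul]
  congr 1
  simp only [E]
  ring

end Necessity

/-- Corollary 3: with the `f_{i,j}, f'_{i,j}` fixed, the family
`{ψ(C_t) : 0 ≤ t < K}` is a `(K, L)`-CCC, `K = ∏ p_i^{n_i+1}`, `L = ∏ p_i^{m_i}`,
for every choice of the `g_{i,j'}`, `f_{i'}`, `h_{i'}`, `λ_{i'}` and of the bijections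
`π_i^c` onto the complements of the `J_i`, iff every `f_{i,j}` and `f'_{i,j}`
permutes `{0,…,p_i−1}` under reduction modulo `p_i`. -/
theorem stmt_14 (k : ℕ) (hk : 1 ≤ k) (p m n : Fin k → ℕ)
    (hp : ∀ i, (p i).Prime) (hmono : StrictMono p)
    (hm : ∀ i, 2 ≤ m i) (hn : ∀ i, n i ≤ m i - 1)
    (J : (i : Fin k) → Fin (n i) → Fin (m i))
    (hJ : ∀ i, Function.Injective (J i))
    (F F' : (i : Fin k) → Fin (m i - n i - 1) → ZMod (∏ l, p l) → ZMod (∏ l, p l)) :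
    (∀ (πc : ((i : Fin k) → Fin (n i) → ℕ) →
          (i : Fin k) → Fin (m i - n i) → Fin (m i))
        (g : (i : Fin k) → Fin (m i - n i) → ZMod (∏ l, p l) → ZMod (∏ l, p l))
        (fcr hcr : Fin (k - 1) → ZMod (∏ l, p l) → ZMod (∏ l, p l))
        (lam : Fin (k - 1) → ZMod (∏ l, p l)),
        (∀ c i, Function.Injective (πc c i) ∧ ∀ a b, πc c i a ≠ J i b) →
        IsCCC (∏ i, p i ^ m i)
          (fun t : Fin (∏ i, p i ^ (n i + 1)) =>
            psiK k hk p m n hm hn J F F' πc g fcr hcr lam t.val)) ↔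
      ∀ (i : Fin k) (j : Fin (m i - n i - 1)),
        PermutesMod (∏ l, p l) (p i) (F i j) ∧
          PermutesMod (∏ l, p l) (p i) (F' i j) := by
  have : NeZero (∏ l, p l) := ⟨(Finset.prod_pos fun i _ => (hp i).pos).ne'⟩
  constructor
  · intro H i j
    choose π hπ using fun i => exists_complementary_path (hJ i)
    exact permutesMod_of_sum_eq_zero (hp i) (Finset.dvd_prod_of_mem p (Finset.mem_univ i)) _ _
      fun α β hαβ => sum_stdAddChar_eq_zero_of_isCCC hk hp hm hn hJ hπ
        (fun g => H (fun _ => π) g 0 0 0 fun _ i => hπ i) i j hαβ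
  · intro hF πc g fcr hcr lam hπ
    exact isCCC_psiK hk hp hm hn hJ hπ hF g fcr hcr lam
end

section
/- Fix integers q ≥ 2, m ≥ 2, functions h_1, …, h_{m−1}, h'_1, …, h'_{m−1}, g_1, …, g_m : ℤ_q → ℤ_q and a permutation π of {1, …, m}, and suppose every h_i and every h'_i (1 ≤ i ≤ m−1) is a permutation of ℤ_q. Define f : ℤ_q^m → ℤ_q by f(x_1,…,x_m) = ∑_{i=1}^{m−1} h_i(x_{π(i)}) h'_i(x_{π(i+1)}) + ∑_{j=1}^m g_j(x_j), and for t ∈ ℤ_q let ψ(C_t) be the code whose d-th sequence (d ∈ ℤ_q) has x-th entry ξ_q^{f(x_1,…,x_m) + d·x_{π(1)} + t·x_{π(m)}}. Then for all t, t' ∈ ℤ_q and every τ with 0 < |τ| < q^m, Θ(ψ(C_t), ψ(C_{t'}))(τ) = 0. -/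
open scoped Classical

/-- The `(j+1)`-st base-`q` digit `x_{j+1}` of `x` (so `x = ∑_j x_{j+1} q^j`),
regarded as an element of `ℤ_q`. -/
def dig (q x j : ℕ) : ZMod q := (((x / q ^ j) % q : ℕ) : ZMod q)

/-- The function `f(x_1,…,x_m) = ∑_{i=1}^{m−1} h_i(x_{π(i)}) h'_i(x_{π(i+1)})
+ ∑_{j=1}^m g_j(x_j)` evaluated at the base-`q` digit vector of `x ∈ {0,…,q^m−1}`.
Here indices are 0-based: `h i`, `h' i` stand for `h_{i+1}`, `h'_{i+1}`, and `π` is a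
permutation of the `m` digit positions. -/
def qfun (q m : ℕ) (hm : 2 ≤ m) (h h' : Fin (m - 1) → ZMod q → ZMod q)
    (g : Fin m → ZMod q → ZMod q) (π : Equiv.Perm (Fin m)) (x : ℕ) : ZMod q :=
  (∑ i : Fin (m - 1),
      h i (dig q x (π (Fin.castLE (by omega) i))) *
        h' i (dig q x (π (Fin.cast (by omega) i.succ)))) +
    ∑ j : Fin m, g j (dig q x j)

/-- `F_{x,t} = f(x_1,…,x_m) + t·x_{π(m)}`. -/
def Fqt (q m : ℕ) (hm : 2 ≤ m) (h h' : Fin (m - 1) → ZMod q → ZMod q)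
    (g : Fin m → ZMod q → ZMod q) (π : Equiv.Perm (Fin m)) (x : ℕ) (t : ZMod q) :
    ZMod q :=
  qfun q m hm h h' g π x + t * dig q x (π ⟨m - 1, by omega⟩)

/-- The code `ψ(C_t)`: its `d`-th sequence (`d ∈ ℤ_q`) has `x`-th entry
`ξ_q^{f(x_1,…,x_m) + d·x_{π(1)} + t·x_{π(m)}}`. -/
noncomputable def psiC (q m : ℕ) (hm : 2 ≤ m) (h h' : Fin (m - 1) → ZMod q → ZMod q)
    (g : Fin m → ZMod q → ZMod q) (π : Equiv.Perm (Fin m)) (t : ZMod q) :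
    ZMod q → ℕ → ℂ :=
  fun d x =>
    xi q ^ (Fqt q m hm h h' g π x t + d * dig q x (π ⟨0, by omega⟩)).val

/-- The digit expansion in base `q`, as a bijection between digit vectors and `{0, …, q ^ m - 1}`. -/
def digitEquiv (q m : ℕ) [NeZero q] : (Fin m → ZMod q) ≃ Fin (q ^ m) :=
  (Equiv.piCongrRight fun _ =>
    { toFun := fun z => (⟨z.val, ZMod.val_lt z⟩ : Fin q)
      invFun := fun i => (i.val : ZMod q)
      left_inv := fun z => ZMod.natCast_zmod_val z
      right_inv := fun i => Fin.ext (ZMod.val_cast_of_lt i.isLt) }).trans finFunctionFinEquiv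

theorem digitEquiv_val (q m : ℕ) [NeZero q] (a : Fin m → ZMod q) :
    (digitEquiv q m a : ℕ) = ∑ j, (a j).val * q ^ (j : ℕ) := by
  simp [digitEquiv]

theorem dig_digitEquiv (q m : ℕ) [NeZero q] (a : Fin m → ZMod q) (j : Fin m) :
    dig q (digitEquiv q m a) j = a j := by
  conv_rhs => rw [← (digitEquiv q m).symm_apply_apply a]
  generalize digitEquiv q m a = x
  simp [digitEquiv, dig, finFunctionFinEquiv]

/-- The polynomial function `f` as a function of the digit vector. -/
def pathForm {q m : ℕ} (hm : 2 ≤ m) (h h' : Fin (m - 1) → ZMod q → ZMod q)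
    (g : Fin m → ZMod q → ZMod q) (π : Equiv.Perm (Fin m)) (a : Fin m → ZMod q) : ZMod q :=
  (∑ i : Fin (m - 1),
      h i (a (π (Fin.castLE (by omega) i))) * h' i (a (π (Fin.cast (by omega) i.succ)))) +
    ∑ j : Fin m, g j (a j)

theorem psiC_digitEquiv {q m : ℕ} [NeZero q] (hm : 2 ≤ m)
    (h h' : Fin (m - 1) → ZMod q → ZMod q) (g : Fin m → ZMod q → ZMod q)
    (π : Equiv.Perm (Fin m)) (t d : ZMod q) (a : Fin m → ZMod q) :
    psiC q m hm h h' g π t d (digitEquiv q m a) =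
      ZMod.stdAddChar (pathForm hm h h' g π a + t * a (π ⟨m - 1, by omega⟩) +
        d * a (π ⟨0, by omega⟩)) := by
  simp only [psiC, Fqt, qfun, pathForm, xi_pow_val, dig_digitEquiv]

theorem accf_eq_sum_ite (L : ℕ) (a b : ℕ → ℂ) (τ : ℤ) :
    accf L a b τ = ∑ x ∈ Finset.range L, ∑ y ∈ Finset.range L,
      if (y : ℤ) = x + τ then a x * (starRingEnd ℂ) (b y) else 0 := by
  rw [← Finset.sum_product', ← Finset.sum_filter, accf]
  split_ifs with hτ
  · refine Finset.sum_bij' (fun t _ => (t, t + τ.toNat)) (fun p _ => p.1) ?_ ?_ ?_ ?_ ?_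
    · intro t ht
      simp only [Finset.mem_filter, Finset.mem_product, Finset.mem_range] at ht ⊢
      omega
    · rintro ⟨x, y⟩ hp
      simp only [Finset.mem_filter, Finset.mem_product, Finset.mem_range] at hp ⊢
      omega
    · simp
    · rintro ⟨x, y⟩ hp
      simp only [Finset.mem_filter, Finset.mem_product, Finset.mem_range, Prod.mk.injEq] at hp ⊢
      exact ⟨trivial, by omega⟩
    · simp
  · refine Finset.sum_bij' (fun t _ => (t + (-τ).toNat, t)) (fun p _ => p.2) ?_ ?_ ?_ ?_ ?_
    · intro t ht
      simp only [Finset.mem_filter, Finset.mem_product, Finset.mem_range] at ht ⊢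
      omega
    · rintro ⟨x, y⟩ hp
      simp only [Finset.mem_filter, Finset.mem_product, Finset.mem_range] at hp ⊢
      omega
    · simp
    · rintro ⟨x, y⟩ hp
      simp only [Finset.mem_filter, Finset.mem_product, Finset.mem_range, Prod.mk.injEq] at hp ⊢
      exact ⟨by omega, trivial⟩
    · simp

theorem sum_range_eq_sum_digitEquiv (q m : ℕ) [NeZero q] (F : ℕ → ℂ) :
    ∑ x ∈ Finset.range (q ^ m), F x = ∑ a : Fin m → ZMod q, F (digitEquiv q m a) := by
  rw [Finset.sum_range, Equiv.sum_comp (digitEquiv q m) fun x => F x]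

/-- Changing a digit on which two numbers agree to another common value keeps their difference. -/
theorem digitEquiv_sub_add_single {q m : ℕ} [NeZero q] {a b : Fin m → ZMod q} {k : Fin m}
    (hk : a k = b k) (s : ZMod q) :
    ((digitEquiv q m (b + Pi.single k s) : ℕ) : ℤ) - (digitEquiv q m (a + Pi.single k s) : ℕ) =
      ((digitEquiv q m b : ℕ) : ℤ) - (digitEquiv q m a : ℕ) := by
  simp only [digitEquiv_val, Nat.cast_sum, ← Finset.sum_sub_distrib]
  refine Finset.sum_congr rfl fun j _ => ?_
  by_cases hj : j = k
  · subst hj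
    simp [hk]
  · simp [hj]

/-- If two digit vectors agree at the first positions of the path, up to `v`, then the difference
of the values of `f` depends on the common digit at position `v` only through one product. -/
theorem exists_pathForm_sub_add_single {q m : ℕ} (hm : 2 ≤ m)
    (h h' : Fin (m - 1) → ZMod q → ZMod q) (g : Fin m → ZMod q → ZMod q)
    (π : Equiv.Perm (Fin m)) (a b : Fin m → ZMod q) (v : Fin (m - 1))
    (hab : ∀ i : Fin m, (i : ℕ) ≤ v → a (π i) = b (π i)) :
    ∃ R : ZMod q, ∀ s : ZMod q,
      pathForm hm h h' g π (a + Pi.single (π (Fin.castLE (Nat.sub_le m 1) v)) s) -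
        pathForm hm h h' g π (b + Pi.single (π (Fin.castLE (Nat.sub_le m 1) v)) s) =
      R + h v (a (π (Fin.castLE (Nat.sub_le m 1) v)) + s) *
        (h' v (a (π (Fin.cast (by omega) v.succ))) -
          h' v (b (π (Fin.cast (by omega) v.succ)))) := by
  refine ⟨(∑ i ∈ Finset.univ.erase v,
    (h i (a (π (Fin.castLE (by omega) i))) * h' i (a (π (Fin.cast (by omega) i.succ))) -
      h i (b (π (Fin.castLE (by omega) i))) * h' i (b (π (Fin.cast (by omega) i.succ))))) +
    ∑ j, (g j (a j) - g j (b j)), fun s => ?_⟩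
  have hv := hab (Fin.castLE (Nat.sub_le m 1) v) le_rfl
  have hg : ∑ j, (g j (a j) - g j (b j)) =
      ∑ j, (g j ((a + Pi.single (π (Fin.castLE (Nat.sub_le m 1) v)) s : Fin m → ZMod q) j) -
        g j ((b + Pi.single (π (Fin.castLE (Nat.sub_le m 1) v)) s : Fin m → ZMod q) j)) := by
    refine Finset.sum_congr rfl fun j _ => ?_
    by_cases hj : j = π (Fin.castLE (Nat.sub_le m 1) v)
    · subst hj
      simp [hv]
    · simp [hj]
  have hne : ∀ i : Fin m, (i : ℕ) ≠ v → ∀ c : Fin m → ZMod q,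
      (c + Pi.single (π (Fin.castLE (Nat.sub_le m 1) v)) s : Fin m → ZMod q) (π i) = c (π i) := by
    intro i hi c
    have : π i ≠ π (Fin.castLE (Nat.sub_le m 1) v) := by
      intro hc
      exact hi (congrArg Fin.val (π.injective hc))
    simp [this]
  have hle : ∀ i : Fin m, (i : ℕ) ≤ v →
      (a + Pi.single (π (Fin.castLE (Nat.sub_le m 1) v)) s : Fin m → ZMod q) (π i) =
        (b + Pi.single (π (Fin.castLE (Nat.sub_le m 1) v)) s : Fin m → ZMod q) (π i) := by
    intro i hi
    simp [hab i hi]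
  rw [pathForm, pathForm, add_sub_add_comm, ← Finset.sum_sub_distrib, ← Finset.sum_sub_distrib,
    ← hg, ← Finset.sum_erase_add _ _ (Finset.mem_univ v), add_right_comm]
  congr 1
  · congr 1
    refine Finset.sum_congr rfl fun i hi => ?_
    have hiv : (i : ℕ) ≠ v := fun hc => (Finset.ne_of_mem_erase hi) (Fin.ext hc)
    rcases lt_or_gt_of_ne hiv with hlt | hgt
    · rw [hle _ (by simpa using hlt.le), hle _ (by simpa using hlt),
        hab _ (by simpa using hlt.le), hab _ (by simpa using hlt)]
      simp
    · simp only [hne (Fin.castLE (by omega) i) (by simpa using hiv),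
        hne (Fin.cast (by omega) i.succ) (by simp; omega)]
  · rw [hne (Fin.cast (by omega) v.succ) (by simp) a, hne (Fin.cast (by omega) v.succ) (by simp) b,
      ← hle _ le_rfl, mul_sub]
    simp

theorem stdAddChar_sum_comp_bijective_mul {q : ℕ} [NeZero q] {φ : ZMod q → ZMod q}
    (hφ : Function.Bijective φ) {e : ZMod q} (he : e ≠ 0) :
    ∑ s, (ZMod.stdAddChar (φ s * e) : ℂ) = 0 := by
  rw [hφ.sum_comp fun u => (ZMod.stdAddChar (u * e) : ℂ),
    AddChar.sum_mulShift e (ZMod.isPrimitive_stdAddChar q), if_neg he, Nat.cast_zero]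

/-- A sum over a finite abelian group vanishes if it vanishes along the orbits of a family of
translations. -/
theorem sum_eq_zero_of_sum_translate {A S : Type*} [AddCommGroup A] [Fintype A] [Fintype S]
    [Nonempty S] (H : A → ℂ) (e : S → A) (hH : ∀ a, ∑ s, H (a + e s) = 0) : ∑ a, H a = 0 := by
  have key : (Fintype.card S : ℂ) * ∑ a, H a = 0 := by
    calc (Fintype.card S : ℂ) * ∑ a, H a = ∑ s : S, ∑ a, H (a + e s) := by
          have hs : ∀ s, ∑ a, H (a + e s) = ∑ a, H a := fun s =>
            Equiv.sum_comp (Equiv.addRight (e s)) H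
          simp [hs]
      _ = 0 := by
          rw [Finset.sum_comm]
          exact Finset.sum_eq_zero fun a _ => hH a
  simpa using key

/-- The total contribution of the pairs of digit vectors with a fixed difference vanishes. -/
theorem sum_correlation_eq_zero {q m : ℕ} [NeZero q] (hm : 2 ≤ m)
    (h h' : Fin (m - 1) → ZMod q → ZMod q) (g : Fin m → ZMod q → ZMod q)
    (π : Equiv.Perm (Fin m))
    (hperm : ∀ i : Fin (m - 1), Function.Bijective (h i) ∧ Function.Bijective (h' i))
    (t t' : ZMod q) {τ : ℤ} (hτ : τ ≠ 0) (c : Fin m → ZMod q) :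
    ∑ a : Fin m → ZMod q,
      (if ((digitEquiv q m (a - c) : ℕ) : ℤ) = (digitEquiv q m a : ℕ) + τ then
        ∑ d : ZMod q, (ZMod.stdAddChar (pathForm hm h h' g π a - pathForm hm h h' g π (a - c) +
          (t * a (π ⟨m - 1, by omega⟩) - t' * (a - c) (π ⟨m - 1, by omega⟩)) +
          d * c (π ⟨0, by omega⟩)) : ℂ) else 0) = 0 := by
  by_cases hc0 : c (π ⟨0, by omega⟩) = 0
  swap
  · refine Finset.sum_eq_zero fun a _ => ?_
    split_ifs
    · simp_rw [AddChar.map_add_eq_mul _ _ (_ * c _)]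
      rw [← Finset.mul_sum]
      exact mul_eq_zero_of_right _
        (stdAddChar_sum_comp_bijective_mul Function.bijective_id hc0)
    · rfl
  by_cases hc : ∀ i, c (π i) = 0
  · have : c = 0 := funext fun j => by simpa using hc (π.symm j)
    subst this
    simp [hτ]
  push Not at hc
  obtain ⟨w, hw, hmin⟩ := wellFounded_lt.has_min {i | c (π i) ≠ 0} hc
  have hlt : ∀ i < w, c (π i) = 0 := fun i hi => by_contra fun hci => hmin i hci hi
  have hw0 : (w : ℕ) ≠ 0 := by
    intro hw0
    exact hw ((congrArg (fun i => c (π i)) (Fin.ext hw0)).trans hc0)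
  obtain ⟨v, hv⟩ : ∃ v : Fin (m - 1), Fin.cast (by omega) v.succ = w :=
    ⟨⟨w - 1, by omega⟩, Fin.ext (by simp; omega)⟩
  have hvw : (v : ℕ) + 1 = w := by simp [← hv]
  have hle : ∀ i : Fin m, (i : ℕ) ≤ v → c (π i) = 0 := fun i hi => hlt i (by
    rw [Fin.lt_def]
    omega)
  refine sum_eq_zero_of_sum_translate _
    (fun s : ZMod q => Pi.single (π (Fin.castLE (Nat.sub_le m 1) v)) s) fun a => ?_
  have hab : ∀ i : Fin m, (i : ℕ) ≤ v → a (π i) = (a - c) (π i) := fun i hi => by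
    simp [hle i hi]
  obtain ⟨R, hR⟩ := exists_pathForm_sub_add_single hm h h' g π a (a - c) v hab
  have hcond : ∀ s : ZMod q,
      (((digitEquiv q m (a - c + Pi.single (π (Fin.castLE (Nat.sub_le m 1) v)) s) : ℕ) : ℤ) =
        (digitEquiv q m (a + Pi.single (π (Fin.castLE (Nat.sub_le m 1) v)) s) : ℕ) + τ) ↔
      ((digitEquiv q m (a - c) : ℕ) : ℤ) = (digitEquiv q m a : ℕ) + τ := fun s => by
    have := digitEquiv_sub_add_single (hab (Fin.castLE (Nat.sub_le m 1) v) le_rfl) s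
    omega
  have hlast : ∀ (s : ZMod q) (b : Fin m → ZMod q),
      (b + Pi.single (π (Fin.castLE (Nat.sub_le m 1) v)) s : Fin m → ZMod q) (π ⟨m - 1, by omega⟩) =
        b (π ⟨m - 1, by omega⟩) := by
    intro s b
    have : (⟨m - 1, by omega⟩ : Fin m) ≠ Fin.castLE (Nat.sub_le m 1) v := by
      intro hc
      have := congrArg Fin.val hc
      have := v.isLt
      simp at *
      omega
    simp [this]
  have he : h' v (a (π w)) - h' v ((a - c) (π w)) ≠ 0 := by
    intro he
    have := (hperm v).2.injective (sub_eq_zero.mp he)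
    exact hw (sub_eq_self.mp this.symm)
  simp only [add_sub_right_comm, hcond, hlast, hR, hc0, mul_zero, add_zero, hv]
  split_ifs
  swap
  · simp
  have hbij : Function.Bijective fun s => h v (a (π (Fin.castLE (Nat.sub_le m 1) v)) + s) :=
    (hperm v).1.comp (Equiv.addLeft _).bijective
  rw [Finset.sum_comm]
  refine Finset.sum_eq_zero fun d _ => ?_
  simp only [AddChar.map_add_eq_mul]
  rw [← Finset.sum_mul, ← Finset.mul_sum, stdAddChar_sum_comp_bijective_mul hbij he]
  simp

/-- if every `h_i` and every `h'_i` is a permutation of `ℤ_q`, then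
for all `t, t' ∈ ℤ_q` and every shift `τ` with `0 < |τ| < q^m`, the ACCF of the codes
`ψ(C_t)` and `ψ(C_{t'})` vanishes. -/
theorem stmt_15 (q m : ℕ) [NeZero q] (hq : 2 ≤ q) (hm : 2 ≤ m)
    (h h' : Fin (m - 1) → ZMod q → ZMod q) (g : Fin m → ZMod q → ZMod q)
    (π : Equiv.Perm (Fin m))
    (hperm : ∀ i : Fin (m - 1), Function.Bijective (h i) ∧ Function.Bijective (h' i))
    (t t' : ZMod q) (τ : ℤ) (hτ : 0 < |τ|) (hτ' : |τ| < (q : ℤ) ^ m) :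
    codeACCF (q ^ m) (psiC q m hm h h' g π t) (psiC q m hm h h' g π t') τ = 0 := by
  have hτ0 : τ ≠ 0 := abs_pos.mp hτ
  simp only [codeACCF, accf_eq_sum_ite, sum_range_eq_sum_digitEquiv, psiC_digitEquiv]
  rw [Finset.sum_comm]
  simp_rw [Finset.sum_comm (s := (Finset.univ : Finset (ZMod q)))]
  have hsub : ∀ F : (Fin m → ZMod q) → (Fin m → ZMod q) → ℂ,
      ∑ a, ∑ b, F a b = ∑ c, ∑ a, F a (a - c) := fun F => by
    rw [Finset.sum_comm (f := fun c a => F a (a - c))]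
    exact Finset.sum_congr rfl fun a _ => (Equiv.sum_comp (Equiv.subLeft a) (F a)).symm
  rw [hsub]
  refine Finset.sum_eq_zero fun c _ => ?_
  refine Eq.trans (Finset.sum_congr rfl fun a _ => ?_)
    (sum_correlation_eq_zero hm h h' g π hperm t t' hτ0 c)
  split_ifs
  · refine Finset.sum_congr rfl fun d _ => ?_
    rw [← AddChar.map_neg_eq_conj, ← AddChar.map_add_eq_mul]
    congr 1
    simp only [Pi.sub_apply]
    ring
  · simp
end
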